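/- arXiv:2207.14523 — 2 statements merged into one kernel-verified Lean document; each statement's English description precedes it below -/
import Mathlib

section
/- Let K be an algebraically closed field and f ∈ K[[x,y]] a reduced power series without constant term. Then μ̄(f) ≥ 0, and μ̄(f) = 0 if and only if ord f = 1. -/
/-!
Common definitions for formalizing "A note on the plane curve singularities in
positive characteristic" by E. García Barroso and A. Płoski.

We work with the ring `K[[x,y]] := MvPowerSeries (Fin 2) K`, where `x` is the
variable of index `0` and `y` the variable of index `1`.
-/

open scoped Classical

noncomputable section

universe u

namespace PlaneCurveNote

/-- The formal power series ring `K[[x,y]]`. -/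
abbrev PS (K : Type u) [Field K] := MvPowerSeries (Fin 2) K

variable (K : Type u) [Field K]

/-- The variable `x`. -/
def Xv : PS K := MvPowerSeries.X 0

/-- The variable `y`. -/
def Yv : PS K := MvPowerSeries.X 1

/-- The coefficient `c_{αβ}` of `x^α y^β` in `f`. -/
def coef (f : PS K) (p : ℕ × ℕ) : K :=
  MvPowerSeries.coeff (Finsupp.single 0 p.1 + Finsupp.single 1 p.2) f

/-- The support of a power series, as a subset of `ℕ²`. -/
def supp (f : PS K) : Set (ℕ × ℕ) := {p | coef K f p ≠ 0}

/-- Build a power series from a coefficient function on `ℕ²`. -/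
def ofCoef (c : ℕ × ℕ → K) : PS K := fun d => c (d 0, d 1)

/-- A reduced power series: nonzero, without constant term and without multiple factors. -/
def IsReducedSeries (f : PS K) : Prop :=
  f ≠ 0 ∧ MvPowerSeries.constantCoeff f = 0 ∧ Squarefree f

/-- `r(f)`: the number of irreducible factors of `f` (counted up to associates,
i.e. the number of distinct irreducible components of the curve `f = 0` when `f` is reduced). -/
def numFactors (f : PS K) : ℕ :=
  Set.ncard {P : Associates (PS K) | Irreducible P ∧ P ∣ Associates.mk f}

/-- The local ring `O_f = K[[x,y]]/(f)` of the curve `f = 0`. -/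
abbrev CurveRing (f : PS K) := PS K ⧸ Ideal.span ({f} : Set (PS K))

/-- `deltaSpec K f d` expresses that `d = δ(f) = dim_K Ō_f/O_f`, where `Ō_f` is the integral
closure of `O_f = K[[x,y]]/(f)` in (any model `L` of) its total ring of fractions. -/
def deltaSpec (f : PS K) (d : ℕ) : Prop :=
  ∀ (L : Type u) [CommRing L] [Algebra K L] [Algebra (CurveRing K f) L]
    [IsScalarTower K (CurveRing K f) L] [IsFractionRing (CurveRing K f) L],
    letI N : Submodule K L := Submodule.span K ((integralClosure (CurveRing K f) L : Set L))
    letI P : Submodule K L := Submodule.span K (Set.range (algebraMap (CurveRing K f) L))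
    d = Module.finrank K (↥N ⧸ (P.comap N.subtype))

/-- `δ(f)`, the delta invariant of `f`. -/
def delta (f : PS K) : ℕ := sInf {d | deltaSpec K f d}

/-- `μ̄(f) = 2δ(f) - r(f) + 1`, the invariant Milnor number of `f`. -/
def muBar (f : PS K) : ℤ := 2 * (delta K f : ℤ) - (numFactors K f : ℤ) + 1

/-- `i₀(f,g) = dim_K K[[x,y]]/(f,g)`, the intersection multiplicity of `f` and `g`
(as a natural number; meaningful when it is finite). -/
def iMult (f g : PS K) : ℕ :=
  Module.finrank K (PS K ⧸ Ideal.span ({f, g} : Set (PS K)))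

/-- `i₀(f,g)` as a cardinal (`dim_K K[[x,y]]/(f,g)`), allowing the infinite case. -/
def iMultC (f g : PS K) : Cardinal :=
  Module.rank K (PS K ⧸ Ideal.span ({f, g} : Set (PS K)))

/-- `Γ(f)`: the semigroup of values of an irreducible `f`, i.e. the set of intersection
multiplicities `i₀(f,g)` where `g` runs over power series with `g ≢ 0 (mod f)`. -/
def valueSemigroup (f : PS K) : Set ℕ :=
  {n | ∃ g : PS K, ¬ f ∣ g ∧ n = iMult K f g}

/-- `ord f`, the order of a power series. -/
def ordSeries (f : PS K) : ℕ := sInf ((fun p => p.1 + p.2) '' supp K f)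

/-- `m = ord f(x,0)`. -/
def ordX (f : PS K) : ℕ := sInf {a : ℕ | (a, 0) ∈ supp K f}

/-- `n = ord f(0,y)`. -/
def ordY (f : PS K) : ℕ := sInf {b : ℕ | (0, b) ∈ supp K f}

/-- `f` is convenient if `f(x,0) f(0,y) ≠ 0`. -/
def Convenient (f : PS K) : Prop :=
  (∃ a : ℕ, (a, 0) ∈ supp K f) ∧ (∃ b : ℕ, (0, b) ∈ supp K f)

/-- A Newton edge: a segment with vertices `(α,β)`, `(α',β') ∈ ℕ²`, `α < α'`, `β' < β`. -/
structure NEdge : Type where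
  A : ℕ × ℕ
  B : ℕ × ℕ
  hx : A.1 < B.1
  hy : B.2 < A.2

/-- `|S|₁ = α' - α`. -/
def NEdge.len1 (S : NEdge) : ℕ := S.B.1 - S.A.1

/-- `|S|₂ = β - β'`. -/
def NEdge.len2 (S : NEdge) : ℕ := S.A.2 - S.B.2

/-- `r(S) = gcd(|S|₁, |S|₂)`. -/
def NEdge.rE (S : NEdge) : ℕ := Nat.gcd S.len1 S.len2

/-- The lattice points lying on the segment `S`. -/
def NEdge.mem (S : NEdge) (p : ℕ × ℕ) : Prop :=
  S.A.1 ≤ p.1 ∧ p.1 ≤ S.B.1 ∧ S.B.2 ≤ p.2 ∧ p.2 ≤ S.A.2 ∧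
    (p.1 - S.A.1) * S.len2 = (S.A.2 - p.2) * S.len1

/-- `[S,T] = min{|S|₁|T|₂, |S|₂|T|₁}`. -/
def bracket (S T : NEdge) : ℕ := min (S.len1 * T.len2) (S.len2 * T.len1)

/-- The Newton polygon `N_f` of `f`, described as the set of compact edges of the boundary of
the Newton diagram of `f`: an edge belongs to `N_f` iff its endpoints lie in the support of `f`
and some weight vector `w` with positive entries attains its minimum on the support of `f`
exactly on this segment. -/
def newtonPolygon (f : PS K) : Set NEdge :=
  {S | S.A ∈ supp K f ∧ S.B ∈ supp K f ∧
    ∃ w : ℕ × ℕ, 0 < w.1 ∧ 0 < w.2 ∧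
      w.1 * S.B.1 + w.2 * S.B.2 = w.1 * S.A.1 + w.2 * S.A.2 ∧
      (∀ p ∈ supp K f, w.1 * S.A.1 + w.2 * S.A.2 ≤ w.1 * p.1 + w.2 * p.2) ∧
      (∀ p ∈ supp K f, w.1 * p.1 + w.2 * p.2 = w.1 * S.A.1 + w.2 * S.A.2 →
        S.A.1 ≤ p.1 ∧ p.1 ≤ S.B.1)}

/-- `|N_f|₁ = Σ_{S ∈ N_f} |S|₁`. -/
def len1N (f : PS K) : ℕ := ∑ᶠ S ∈ newtonPolygon K f, S.len1

/-- `|N_f|₂ = Σ_{S ∈ N_f} |S|₂`. -/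
def len2N (f : PS K) : ℕ := ∑ᶠ S ∈ newtonPolygon K f, S.len2

/-- `[N_f, N_f] = Σ_{S,T ∈ N_f} [S,T]`. -/
def bracketN (f : PS K) : ℕ := ∑ᶠ S ∈ newtonPolygon K f, ∑ᶠ T ∈ newtonPolygon K f, bracket S T

/-- `k`: the exponent of the highest power of `x` dividing `f`. -/
def kdiv (f : PS K) : ℕ := sInf {a : ℕ | ∃ b : ℕ, (a, b) ∈ supp K f}

/-- `l`: the exponent of the highest power of `y` dividing `f`. -/
def ldiv (f : PS K) : ℕ := sInf {b : ℕ | ∃ a : ℕ, (a, b) ∈ supp K f}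

/-- `r(N_f) = Σ_{S ∈ N_f} r(S) + k + l`, where `x^k y^l` is the monomial of highest degree
dividing `f`. -/
def rNewton (f : PS K) : ℕ := (∑ᶠ S ∈ newtonPolygon K f, S.rE) + kdiv K f + ldiv K f

/-- `μ(N_f) = [N_f,N_f] - |N_f|₁ - |N_f|₂ + 1` (the Newton number of a convenient series). -/
def muNewtonConv (f : PS K) : ℤ :=
  (bracketN K f : ℤ) - (len1N K f : ℤ) - (len2N K f : ℤ) + 1

/-- `μ(N_f) = sup_{m ∈ ℕ} μ(N_{f + x^m + y^m})`: the Newton number of an arbitrary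
(reduced) power series. -/
def muNewton (f : PS K) : ℤ :=
  sSup {z : ℤ | ∃ m : ℕ, z = muNewtonConv K (f + Xv K ^ m + Yv K ^ m)}

/-- `δ(N_f) = (μ(N_f) + r(N_f) - 1)/2`. -/
def deltaNewton (f : PS K) : ℤ := (muNewton K f + (rNewton K f : ℤ) - 1) / 2

/-- `in(f,S) = Σ_{(α,β) ∈ S} c_{αβ} x^α y^β`, the initial part of `f` along the edge `S`. -/
def initialForm (f : PS K) (S : NEdge) : PS K :=
  ofCoef K fun p => if S.mem p then coef K f p else 0

/-- `ī(f,S)`: the convenient power series with `in(f,S) = x^{α(S)} y^{β(S)} ī(f,S)`,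
where `x^{α(S)} y^{β(S)}` is the monomial of highest degree dividing `in(f,S)`. -/
def inBar (f : PS K) (S : NEdge) : PS K :=
  ofCoef K fun p =>
    if S.mem (p.1 + S.A.1, p.2 + S.B.2) then coef K f (p.1 + S.A.1, p.2 + S.B.2) else 0

/-- `f` is non-degenerate (in the sense of Beelen–Pellikaan) if `ī(f,S)` is reduced
(i.e. squarefree) for every edge `S ∈ N_f`. -/
def NonDegenerate (f : PS K) : Prop :=
  ∀ S ∈ newtonPolygon K f, Squarefree (inBar K f S)

/-- `f` is elementary if it is convenient and `N_f` consists of a single edge. -/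
def Elementary (f : PS K) : Prop :=
  Convenient K f ∧ ∃ S : NEdge, newtonPolygon K f = {S}

/-- Evaluation of a power series with finite support (e.g. an initial form) at a point of `K²`. -/
def psEval (f : PS K) (v : K × K) : K :=
  ∑ᶠ p : ℕ × ℕ, coef K f p * v.1 ^ p.1 * v.2 ^ p.2

/-- The partial derivative `∂f/∂x` (for `i = 0`) resp. `∂f/∂y` (for `i = 1`). -/
def pderivSeries (i : Fin 2) (f : PS K) : PS K :=
  ofCoef K fun p =>
    if i = 0 then ((p.1 + 1 : ℕ) : K) * coef K f (p.1 + 1, p.2)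
    else ((p.2 + 1 : ℕ) : K) * coef K f (p.1, p.2 + 1)

/-- `μ(f) = i₀(∂f/∂x, ∂f/∂y)`, the Milnor number of `f`. -/
def milnor (f : PS K) : ℕ := iMult K (pderivSeries K 0 f) (pderivSeries K 1 f)

/-- `f` is strongly non-degenerate (Kouchnirenko) if for every `S ∈ N_f` the solutions of
`∂in(f,S)/∂x = ∂in(f,S)/∂y = 0` are contained in `{xy = 0}`. -/
def StronglyNonDegenerate (f : PS K) : Prop :=
  ∀ S ∈ newtonPolygon K f, ∀ v : K × K,
    psEval K (pderivSeries K 0 (initialForm K f S)) v = 0 →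
    psEval K (pderivSeries K 1 (initialForm K f S)) v = 0 → v.1 * v.2 = 0

/-- The Newton diagram `Δ(f) ⊆ ℝ²`: the convex hull of `supp f + (ℝ_{≥0})²`. -/
def diagram (f : PS K) : Set (ℝ × ℝ) :=
  convexHull ℝ {q : ℝ × ℝ | ∃ p ∈ supp K f, (p.1 : ℝ) ≤ q.1 ∧ (p.2 : ℝ) ≤ q.2}

/-- A real point lies on the Newton polygon `N_f` (i.e. on a compact face of the boundary of
the Newton diagram) iff it belongs to the diagram and some linear form with positive
coefficients attains its minimum over the diagram at this point. -/
def OnNewtonPolygon (f : PS K) (q : ℝ × ℝ) : Prop :=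
  q ∈ diagram K f ∧ ∃ w : ℝ × ℝ, 0 < w.1 ∧ 0 < w.2 ∧
    ∀ p ∈ diagram K f, w.1 * q.1 + w.2 * q.2 ≤ w.1 * p.1 + w.2 * p.2

end PlaneCurveNote

section FiniteOverPowerSeries

open PowerSeries

theorem algebraMap_C_mul_eq_smul {K O L : Type*} [Field K] [CommRing O] [CommRing L]
    [Algebra K⟦X⟧ O] [Algebra O L] [Algebra K O] [IsScalarTower K K⟦X⟧ O] [Algebra K L]
    [IsScalarTower K O L] (k : K) (b : L) :
    algebraMap O L (algebraMap K⟦X⟧ O (C k)) * b = k • b := by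
  rw [Algebra.smul_def, IsScalarTower.algebraMap_apply K O L,
    IsScalarTower.algebraMap_apply K K⟦X⟧ O, PowerSeries.algebraMap_apply,
    Algebra.algebraMap_self_apply]

variable {K O L : Type*} [Field K] [CommRing O] [CommRing L] [Algebra K⟦X⟧ O]
  [Module.Finite K⟦X⟧ O] [Algebra O L] [IsFractionRing O L]

/-- In a reduced finite `K⟦X⟧`-algebra, `u` and `u ^ 2` generate the same ideal up to a power
of `X`. -/
theorem exists_algebraMap_X_pow_mul_eq_sq_mul [IsReduced O] (u : O) :
    ∃ (m : ℕ) (q : O), algebraMap K⟦X⟧ O X ^ m * u = u ^ 2 * q := by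
  obtain ⟨p, hp, hpu⟩ := Algebra.IsIntegral.isIntegral (R := K⟦X⟧) u
  obtain ⟨g, hg, hdvd⟩ := p.exists_eq_pow_rootMultiplicity_mul_and_not_dvd hp.ne_zero 0
  rw [map_zero, sub_zero] at hg hdvd
  rw [Polynomial.X_dvd_iff] at hdvd
  set j := p.rootMultiplicity 0
  change Polynomial.aeval u p = 0 at hpu
  rw [hg, map_mul, map_pow, Polynomial.aeval_X] at hpu
  have huv : u * Polynomial.aeval u g = 0 := by
    refine IsReduced.eq_zero _ ⟨j + 1, ?_⟩
    rw [mul_pow, pow_succ, pow_succ]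
    linear_combination (u * Polynomial.aeval u g ^ j) * hpu
  obtain ⟨m, ε, hε⟩ := IsDiscreteValuationRing.eq_unit_mul_pow_irreducible hdvd
    (PowerSeries.X_prime (R := K)).irreducible
  have hg' := congrArg (Polynomial.aeval u) g.divX_mul_X_add
  rw [map_add, map_mul, Polynomial.aeval_X, Polynomial.aeval_C, hε, map_mul, map_pow] at hg'
  refine ⟨m, -(algebraMap K⟦X⟧ O (↑ε⁻¹)) * Polynomial.aeval u g.divX, ?_⟩
  have hunit : algebraMap K⟦X⟧ O (↑ε⁻¹) * algebraMap K⟦X⟧ O ↑ε = 1 := by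
    rw [← map_mul, Units.inv_mul, map_one]
  rw [← hg'] at huv
  linear_combination (-(algebraMap K⟦X⟧ O X ^ m * u)) * hunit + algebraMap K⟦X⟧ O (↑ε⁻¹) * huv

theorem exists_algebraMap_X_pow_mul_eq_algebraMap [IsReduced O] (b : L) :
    ∃ (m : ℕ) (u : O), algebraMap O L (algebraMap K⟦X⟧ O X) ^ m * b = algebraMap O L u := by
  obtain ⟨⟨v, s⟩, hs⟩ := IsLocalization.surj (nonZeroDivisors O) b
  obtain ⟨m, q, hq⟩ := exists_algebraMap_X_pow_mul_eq_sq_mul (K := K) (s : O)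
  have hq' : algebraMap K⟦X⟧ O X ^ m = s * q := by
    refine (mul_cancel_right_mem_nonZeroDivisors s.2).mp ?_
    rw [hq]; ring
  refine ⟨m, v * q, ?_⟩
  rw [← map_pow, hq', map_mul, map_mul, ← hs]
  ring

/-- The integral closure of a local ring `O`, finite over `K⟦X⟧`, is `X`-adically separated. -/
theorem eq_zero_of_forall_exists_X_pow_mul [IsReduced O] [IsLocalRing O]
    (hx : algebraMap K⟦X⟧ O X ∈ nonZeroDivisors O) (hx' : ¬ IsUnit (algebraMap K⟦X⟧ O X))
    (b : L) (hb : ∀ k : ℕ, ∃ b' ∈ integralClosure O L,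
      b = algebraMap O L (algebraMap K⟦X⟧ O X) ^ k * b') : b = 0 := by
  set x := algebraMap K⟦X⟧ O X with hxdef
  obtain ⟨N, u, hu⟩ := exists_algebraMap_X_pow_mul_eq_algebraMap (K := K) (O := O) b
  obtain ⟨m, q, hq⟩ := exists_algebraMap_X_pow_mul_eq_sq_mul (K := K) u
  obtain ⟨b', hb', hbb'⟩ := hb (m + 1)
  rw [← hxdef] at hu hq
  have hxL (n : ℕ) : IsUnit (algebraMap O L x ^ n) :=
    (IsLocalization.map_units L (⟨x, hx⟩ : nonZeroDivisors O)).pow n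
  have hc : algebraMap O L x ^ N * b' * algebraMap O L q ∈ integralClosure O L :=
    mul_mem (mul_mem (pow_mem (Subalgebra.algebraMap_mem _ _) _) hb')
      (Subalgebra.algebraMap_mem _ _)
  set c := algebraMap O L x ^ N * b' * algebraMap O L q with hcdef
  have huc : algebraMap O L u * (algebraMap O L x * c) = algebraMap O L u := by
    refine (hxL m).mul_left_cancel ?_
    have h := congrArg (algebraMap O L) hq
    rw [map_mul, map_mul, map_pow, map_pow, ← hu, hbb'] at h
    rw [← hu, hbb', hcdef]
    linear_combination -h
  obtain ⟨p, hp, hpc⟩ := hc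
  have hroot := Polynomial.scaleRoots_eval₂_mul (p := p) (algebraMap O L) (s := x) (r := c)
  rw [hpc, mul_zero] at hroot
  have hpow (i : ℕ) : algebraMap O L u * (algebraMap O L x * c) ^ i = algebraMap O L u := by
    induction i with
    | zero => simp
    | succ i ih => rw [pow_succ, ← mul_assoc, ih, huc]
  have hu1 : u * (p.scaleRoots x).eval 1 = 0 := by
    apply IsFractionRing.injective O L
    rw [map_zero, map_mul, ← mul_zero (algebraMap O L u), ← hroot, Polynomial.eval₂_eq_sum_range,
      Polynomial.eval_eq_sum_range, map_sum, Finset.mul_sum, Finset.mul_sum]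
    refine Finset.sum_congr rfl fun i _ => ?_
    rw [one_pow, mul_one]
    linear_combination (-algebraMap O L ((p.scaleRoots x).coeff i)) * hpow i
  have hun : IsUnit ((p.scaleRoots x).eval 1) := by
    rw [Polynomial.eval_eq_sum_range, Finset.sum_range_succ]
    have h1 : (p.scaleRoots x).coeff (p.scaleRoots x).natDegree = 1 :=
      (Polynomial.monic_scaleRoots_iff x).mpr hp
    rw [h1, one_pow, mul_one]
    have hmem : ∑ i ∈ Finset.range (p.scaleRoots x).natDegree, (p.scaleRoots x).coeff i * 1 ^ i ∈
        IsLocalRing.maximalIdeal O := by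
      refine Ideal.sum_mem _ fun i hi => ?_
      rw [Polynomial.natDegree_scaleRoots, Finset.mem_range] at hi
      rw [Polynomial.coeff_scaleRoots, one_pow, mul_one]
      exact Ideal.mul_mem_left _ _ (Ideal.pow_mem_of_mem _ hx' _ (Nat.sub_pos_of_lt hi))
    by_contra hnu
    have := Ideal.sub_mem _ (show _ ∈ IsLocalRing.maximalIdeal O from hnu) hmem
    rw [add_sub_cancel_left] at this
    exact this isUnit_one
  have hu0 : u = 0 := hun.mul_left_eq_zero.mp hu1
  rw [hu0, map_zero] at hu
  exact (hxL N).mul_right_eq_zero.mp hu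

/-- A common power of `X` clears the denominators of a finite family in the fraction ring. -/
theorem exists_forall_algebraMap_X_pow_mul_eq_algebraMap [IsReduced O] {ι : Type*} [Fintype ι]
    (b : ι → L) : ∃ (m : ℕ) (u : ι → O),
      ∀ i, algebraMap O L (algebraMap K⟦X⟧ O X) ^ m * b i = algebraMap O L (u i) := by
  choose m u hu using fun i => exists_algebraMap_X_pow_mul_eq_algebraMap (K := K) (O := O) (b i)
  refine ⟨∑ i, m i, fun i => algebraMap K⟦X⟧ O X ^ (∑ j, m j - m i) * u i, fun i => ?_⟩
  rw [map_mul, ← hu, map_pow, ← mul_assoc, ← pow_add,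
    Nat.sub_add_cancel (Finset.single_le_sum (fun _ _ => Nat.zero_le _) (Finset.mem_univ i))]

/-- A finite nonzero family of power series becomes nonzero at the origin after dividing by a
suitable power of `X`. -/
theorem exists_eq_X_pow_mul_constantCoeff_ne_zero {ι : Type*} [Fintype ι] (a : ι → K⟦X⟧)
    (ha : ∃ i, a i ≠ 0) : ∃ (m : ℕ) (a' : ι → K⟦X⟧), (∀ i, a i = X ^ m * a' i) ∧
      ∃ i, constantCoeff (a' i) ≠ 0 := by
  obtain ⟨i₀, hi₀⟩ := ha
  obtain ⟨i, -, hi⟩ := Finset.exists_min_image Finset.univ (fun i => (a i).order)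
    ⟨i₀, Finset.mem_univ _⟩
  have hne : a i ≠ 0 := by
    intro h
    have := hi i₀ (Finset.mem_univ _)
    rw [h, order_zero, top_le_iff, order_eq_top] at this
    exact hi₀ this
  have hdvd (j : ι) : (X : K⟦X⟧) ^ (a i).order.toNat ∣ a j := by
    refine X_pow_dvd_iff.mpr fun m hm => coeff_of_lt_order m ?_
    refine lt_of_lt_of_le ?_ (hi j (Finset.mem_univ _))
    rw [← ENat.natCast_toNat (order_eq_top.not.mpr hne)]
    exact_mod_cast hm
  choose a' ha' using hdvd
  refine ⟨_, a', ha', i, fun h0 => ?_⟩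
  obtain ⟨w, hw⟩ := X_dvd_iff.mpr h0
  have : (X : K⟦X⟧) ^ ((a i).order.toNat + 1) ∣ a i := ⟨w, by rw [pow_succ, mul_assoc, ← hw, ← ha']⟩
  exact coeff_order hne (X_pow_dvd_iff.mp this _ (Nat.lt_succ_self _))

variable [Algebra K O] [IsScalarTower K K⟦X⟧ O] [Algebra K L] [IsScalarTower K O L]

/-- More than `finrank K⟦X⟧ O` integral elements are linearly dependent modulo `X`. -/
theorem exists_sum_smul_eq_X_mul [IsReduced O] (hx : algebraMap K⟦X⟧ O X ∈ nonZeroDivisors O)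
    {ι : Type*} [Fintype ι] (hι : Module.finrank K⟦X⟧ O < Fintype.card ι) (b : ι → L)
    (hb : ∀ i, b i ∈ integralClosure O L) :
    ∃ c : ι → K, (∃ i, c i ≠ 0) ∧ ∃ b' ∈ integralClosure O L,
      ∑ i, c i • b i = algebraMap O L (algebraMap K⟦X⟧ O X) * b' := by
  obtain ⟨N, u, hu⟩ := exists_forall_algebraMap_X_pow_mul_eq_algebraMap (K := K) (O := O) b
  have hdep : ¬ LinearIndependent K⟦X⟧ u := fun h => hι.not_ge h.fintype_card_le_finrank
  obtain ⟨a, ha0, ha⟩ := Fintype.not_linearIndependent_iff.mp hdep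
  obtain ⟨m, a', ha', i₀, hi₀⟩ := exists_eq_X_pow_mul_constantCoeff_ne_zero a ha
  have hxL (n : ℕ) : IsUnit (algebraMap O L (algebraMap K⟦X⟧ O X) ^ n) :=
    (IsLocalization.map_units L (⟨_, hx⟩ : nonZeroDivisors O)).pow n
  have hsum : ∑ i, algebraMap O L (algebraMap K⟦X⟧ O (a' i)) * b i = 0 := by
    refine (hxL (m + N)).mul_left_cancel ?_
    rw [mul_zero, ← map_zero (algebraMap O L), ← ha0, map_sum, Finset.mul_sum]
    refine Finset.sum_congr rfl fun i _ => ?_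
    rw [Algebra.smul_def, map_mul, ← hu, ha' i, map_mul, map_mul, map_pow, map_pow]
    ring
  choose w hw using fun i => show X ∣ a' i - C (constantCoeff (a' i)) from
    X_dvd_iff.mpr (by simp)
  refine ⟨fun i => constantCoeff (a' i), ⟨i₀, hi₀⟩,
    -∑ i, algebraMap O L (algebraMap K⟦X⟧ O (w i)) * b i,
    neg_mem (sum_mem fun i _ => mul_mem (Subalgebra.algebraMap_mem _ _) (hb i)), ?_⟩
  rw [mul_neg, eq_neg_iff_add_eq_zero, Finset.mul_sum, ← Finset.sum_add_distrib, ← hsum]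
  refine Finset.sum_congr rfl fun i _ => ?_
  rw [← algebraMap_C_mul_eq_smul (O := O), ← mul_assoc, ← map_mul, ← map_mul, ← hw, ← add_mul,
    ← map_add, ← map_add, add_sub_cancel]

/-- The integral closure is finitely generated modulo `X`. -/
theorem exists_generators_mod_X [IsReduced O] (hx : algebraMap K⟦X⟧ O X ∈ nonZeroDivisors O) :
    ∃ (n : ℕ) (g : Fin n → L), (∀ i, g i ∈ integralClosure O L) ∧
      ∀ b ∈ integralClosure O L, ∃ c : Fin n → K, ∃ b' ∈ integralClosure O L,
        b = ∑ i, c i • g i + algebraMap O L (algebraMap K⟦X⟧ O X) * b' := by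
  let N : Submodule K L := (Subalgebra.toSubmodule (integralClosure O L)).restrictScalars K
  let D : Submodule K N :=
    (N.map (LinearMap.mulLeft K (algebraMap O L (algebraMap K⟦X⟧ O X)))).comap N.subtype
  have hrank : Module.rank K (N ⧸ D) ≤ Module.finrank K⟦X⟧ O := by
    refine rank_le fun s hs => ?_
    by_contra! hlt
    choose b hb using fun i : s => D.mkQ_surjective i.1
    obtain ⟨c, ⟨i, hi⟩, b', hb', hsum⟩ := exists_sum_smul_eq_X_mul (L := L) hx
      (ι := s) (by simpa using hlt) (fun i => (b i : L)) (fun i => (b i).2)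
    refine hi (Fintype.linearIndependent_iff.mp hs c ?_ i)
    have : ∑ i, c i • D.mkQ (b i) = 0 := by
      simp_rw [← map_smul, ← map_sum]
      rw [Submodule.mkQ_apply, Submodule.Quotient.mk_eq_zero]
      refine ⟨b', hb', ?_⟩
      simpa using hsum.symm
    simpa [hb] using this
  have : Module.Finite K (N ⧸ D) :=
    Module.rank_lt_aleph0_iff.mp (hrank.trans_lt Cardinal.natCast_lt_aleph0)
  obtain ⟨n, t, ht⟩ := Module.Finite.exists_fin (R := K) (M := N ⧸ D)
  choose g hg using fun i => D.mkQ_surjective (t i)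
  refine ⟨n, fun i => g i, fun i => (g i).2, fun b hb => ?_⟩
  obtain ⟨c, hc⟩ := (Submodule.mem_span_range_iff_exists_fun K).mp
    (show D.mkQ ⟨b, hb⟩ ∈ Submodule.span K (Set.range t) from ht ▸ Submodule.mem_top)
  simp_rw [← hg, ← map_smul, ← map_sum] at hc
  obtain ⟨b', hb', h⟩ := (Submodule.Quotient.eq D).mp hc.symm
  refine ⟨c, b', hb', ?_⟩
  rw [LinearMap.mulLeft_apply] at h
  rw [h]
  simp

/-- The integral closure is a finite `K⟦X⟧`-module. -/
theorem exists_generators_integralClosure [IsReduced O] [IsLocalRing O]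
    (hx : algebraMap K⟦X⟧ O X ∈ nonZeroDivisors O) (hx' : ¬ IsUnit (algebraMap K⟦X⟧ O X)) :
    ∃ (n : ℕ) (g : Fin n → L), (∀ i, g i ∈ integralClosure O L) ∧
      ∀ b ∈ integralClosure O L, ∃ c : Fin n → K⟦X⟧,
        b = ∑ i, algebraMap O L (algebraMap K⟦X⟧ O (c i)) * g i := by
  obtain ⟨n, g, hg, hgen⟩ := exists_generators_mod_X (K := K) (O := O) (L := L) hx
  refine ⟨n, g, hg, fun b hb => ?_⟩
  choose c next hnext heq using fun b : integralClosure O L => hgen b b.2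
  let seq (k : ℕ) : integralClosure O L := (fun b => ⟨next b, hnext b⟩)^[k] ⟨b, hb⟩
  have hseq (k : ℕ) : (seq k : L) =
      ∑ i, c (seq k) i • g i + algebraMap O L (algebraMap K⟦X⟧ O X) * seq (k + 1) := by
    rw [heq (seq k)]
    simp only [seq, Function.iterate_succ_apply']
  let a (k : ℕ) (i : Fin n) : K⟦X⟧ := PowerSeries.mk fun j => c (seq (k + j)) i
  have ha (k : ℕ) (i : Fin n) : a k i = C (c (seq k) i) + X * a (k + 1) i := by
    ext (_ | j)
    · simp [a]
    · simp [a, coeff_succ_X_mul, add_assoc, add_comm 1 j]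
  have hrem (k : ℕ) : (seq 0 : L) - ∑ i, algebraMap O L (algebraMap K⟦X⟧ O (a 0 i)) * g i =
      algebraMap O L (algebraMap K⟦X⟧ O X) ^ k *
        (seq k - ∑ i, algebraMap O L (algebraMap K⟦X⟧ O (a k i)) * g i) := by
    induction k with
    | zero => rw [pow_zero, one_mul]
    | succ k ih =>
      rw [ih, hseq k, pow_succ, mul_assoc]
      congr 1
      simp_rw [ha k, map_add, add_mul, algebraMap_C_mul_eq_smul, Finset.sum_add_distrib, map_mul,
        mul_sub, Finset.mul_sum, mul_assoc]
      ring
  refine ⟨a 0, sub_eq_zero.mp (eq_zero_of_forall_exists_X_pow_mul (K := K) (O := O) hx hx' _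
    fun k => ⟨_, ?_, hrem k⟩)⟩
  exact sub_mem (seq k).2 (sum_mem fun i _ => mul_mem (Subalgebra.algebraMap_mem _ _) (hg i))

/-- The integral closure of `O` exceeds `O` by a finite-dimensional space. -/
theorem exists_finite_le_span_sup_range [IsReduced O] [IsLocalRing O]
    (hx : algebraMap K⟦X⟧ O X ∈ nonZeroDivisors O) (hx' : ¬ IsUnit (algebraMap K⟦X⟧ O X)) :
    ∃ S : Set L, S.Finite ∧ (integralClosure O L : Set L) ⊆
      (Submodule.span K S ⊔ Submodule.span K (Set.range (algebraMap O L)) : Submodule K L) := by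
  obtain ⟨n, g, hg, hgen⟩ := exists_generators_integralClosure (K := K) (O := O) (L := L) hx hx'
  obtain ⟨m, u, hu⟩ := exists_forall_algebraMap_X_pow_mul_eq_algebraMap (K := K) (O := O) g
  set x := algebraMap O L (algebraMap K⟦X⟧ O X) with hxdef
  refine ⟨Set.range fun p : Fin m × Fin n => x ^ (p.1 : ℕ) * g p.2, Set.finite_range _, ?_⟩
  intro b hb
  obtain ⟨c, rfl⟩ := hgen b hb
  refine sum_mem fun i _ => ?_
  have hc := eq_X_pow_mul_shift_add_trunc m (c i)
  rw [hc, map_add, map_add, add_mul, add_comm]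
  refine add_mem (Submodule.mem_sup_left ?_) (Submodule.mem_sup_right (Submodule.subset_span ?_))
  · have htrunc : (trunc m (c i) : K⟦X⟧) = ∑ j : Fin m, C (coeff j (c i)) * X ^ (j : ℕ) := by
      rw [Fin.sum_univ_eq_sum_range fun j => C (coeff j (c i)) * X ^ j]
      ext k
      simp [coeff_trunc, coeff_X_pow]
    rw [htrunc, map_sum, map_sum, Finset.sum_mul]
    refine sum_mem fun j _ => ?_
    rw [map_mul, map_mul, mul_assoc, algebraMap_C_mul_eq_smul, map_pow, map_pow]
    exact Submodule.smul_mem _ _ (Submodule.subset_span ⟨(j, i), rfl⟩)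
  · refine ⟨algebraMap K⟦X⟧ O (mk fun j => coeff (j + m) (c i)) * u i, ?_⟩
    rw [map_mul, ← hu, map_mul, map_mul, map_pow, map_pow]
    ring

end FiniteOverPowerSeries

section DeltaQuotient

variable (K O L : Type*) [Field K] [CommRing O] [CommRing L] [Algebra O L]
  [Algebra K L]

/-- The `K`-span of the integral closure of `O` in `L`. -/
abbrev normalizationSpan : Submodule K L :=
  Submodule.span K (integralClosure O L : Set L)

/-- The `K`-span of the image of `O` in `L`. -/
abbrev baseSpan : Submodule K L :=
  Submodule.span K (Set.range (algebraMap O L))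

/-- The quotient of the integral closure of `O` in `L` by the image of `O`. -/
abbrev DeltaQuotient : Type _ :=
  normalizationSpan K O L ⧸ (baseSpan K O L).comap (normalizationSpan K O L).subtype

variable {K O L}

theorem finite_deltaQuotient {S : Set L} (hS : S.Finite)
    (h : (integralClosure O L : Set L) ⊆ (Submodule.span K S ⊔ baseSpan K O L : Submodule K L)) :
    Module.Finite K (DeltaQuotient K O L) := by
  let φ : DeltaQuotient K O L →ₗ[K] L ⧸ baseSpan K O L :=
    Submodule.mapQ _ _ (normalizationSpan K O L).subtype le_rfl
  have hφ : Function.Injective φ := by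
    rw [← LinearMap.ker_eq_bot, Submodule.ker_mapQ, Submodule.mkQ_map_self]
  have : Module.Finite K ((Submodule.span K S).map (baseSpan K O L).mkQ) :=
    have := Module.Finite.iff_fg.mpr (Submodule.fg_span (R := K) hS)
    inferInstance
  have hrange (q) : φ q ∈ (Submodule.span K S).map (baseSpan K O L).mkQ := by
    obtain ⟨⟨b, hb⟩, rfl⟩ := Submodule.mkQ_surjective _ q
    obtain ⟨s, hs, p, hp, hsp⟩ := Submodule.mem_sup.mp (Submodule.span_le.mpr h hb)
    refine ⟨s, hs, ?_⟩
    change (baseSpan K O L).mkQ s = (baseSpan K O L).mkQ b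
    rw [← hsp, map_add, Submodule.mkQ_apply _ p, (Submodule.Quotient.mk_eq_zero _).mpr hp, add_zero]
  exact Module.Finite.of_injective (φ.codRestrict _ hrange)
    fun a b hab => hφ (congrArg Subtype.val hab)

variable [Algebra K O]

theorem mem_baseSpan_iff [IsScalarTower K O L] {b : L} :
    b ∈ baseSpan K O L ↔ ∃ a : O, algebraMap O L a = b := by
  have h : baseSpan K O L = LinearMap.range (IsScalarTower.toAlgHom K O L).toLinearMap :=
    Submodule.span_eq (LinearMap.range (IsScalarTower.toAlgHom K O L).toLinearMap)
  rw [h]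
  rfl

/-- The quotient of the integral closure does not depend on the model of the fraction ring. -/
theorem finrank_deltaQuotient_congr {L' : Type*} [CommRing L'] [Algebra O L'] [Algebra K L']
    [IsScalarTower K O L] [IsScalarTower K O L'] (e : L ≃ₐ[O] L') :
    Module.finrank K (DeltaQuotient K O L) = Module.finrank K (DeltaQuotient K O L') := by
  let eK : L ≃ₗ[K] L' := (e.restrictScalars K).toLinearEquiv
  have hN : (normalizationSpan K O L).map (eK : L →ₗ[K] L') = normalizationSpan K O L' := by
    rw [Submodule.map_span]
    congr 1
    ext b
    constructor
    · rintro ⟨a, ha, rfl⟩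
      exact IsIntegral.map e ha
    · intro hb
      exact ⟨e.symm b, IsIntegral.map e.symm hb, e.apply_symm_apply b⟩
  let eN : normalizationSpan K O L ≃ₗ[K] normalizationSpan K O L' :=
    eK.ofSubmodules _ _ hN
  refine LinearEquiv.finrank_eq (Submodule.Quotient.equiv _ _ eN ?_)
  ext ⟨b, hb⟩
  rw [Submodule.mem_map, Submodule.mem_comap, Submodule.subtype_apply, mem_baseSpan_iff]
  constructor
  · rintro ⟨a, ha, hab⟩
    rw [Submodule.mem_comap, Submodule.subtype_apply, mem_baseSpan_iff] at ha
    obtain ⟨c, hc⟩ := ha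
    refine ⟨c, ?_⟩
    rw [← e.commutes, hc]
    exact congrArg Subtype.val hab
  · rintro ⟨c, hc⟩
    refine ⟨eN.symm ⟨b, hb⟩, ?_, eN.apply_symm_apply _⟩
    rw [Submodule.mem_comap, Submodule.subtype_apply, mem_baseSpan_iff]
    refine ⟨c, ?_⟩
    change _ = e.symm b
    rw [← show algebraMap O L' c = b from hc]
    exact (e.symm.commutes c).symm

theorem finrank_deltaQuotient_eq_zero_iff [IsScalarTower K O L]
    [Module.Finite K (DeltaQuotient K O L)] : Module.finrank K (DeltaQuotient K O L) = 0 ↔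
      ∀ b : L, IsIntegral O b → ∃ a : O, algebraMap O L a = b := by
  rw [Module.finrank_zero_iff, Submodule.Quotient.subsingleton_iff,
    Submodule.comap_subtype_eq_top, Submodule.span_le]
  exact forall₂_congr fun b hb => mem_baseSpan_iff

theorem finrank_deltaQuotient_eq_zero [IsScalarTower K O L]
    (h : ∀ b : L, IsIntegral O b → ∃ a : O, algebraMap O L a = b) :
    Module.finrank K (DeltaQuotient K O L) = 0 := by
  have : Module.Finite K (DeltaQuotient K O L) :=
    finite_deltaQuotient Set.finite_empty fun b hb =>
      Submodule.mem_sup_right (mem_baseSpan_iff.mpr (h b hb))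
  exact finrank_deltaQuotient_eq_zero_iff.mpr h

/-- Nonzero orthogonal idempotents in the fraction ring of a local ring bound the dimension
of the quotient of the integral closure from below. -/
theorem card_le_finrank_deltaQuotient_add_one [IsLocalRing O] [IsScalarTower K O L]
    [Module.Finite K (DeltaQuotient K O L)] {ι : Type*} [Fintype ι] (e : ι → L)
    (hidem : ∀ i, e i * e i = e i) (horth : ∀ i j, i ≠ j → e i * e j = 0) (hne : ∀ i, e i ≠ 0) :
    Fintype.card ι ≤ Module.finrank K (DeltaQuotient K O L) + 1 := by
  have hmem (i : ι) : e i ∈ normalizationSpan K O L := by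
    refine Submodule.subset_span ⟨Polynomial.X ^ 2 - Polynomial.X, ?_, ?_⟩
    · monicity!
    · simp [pow_two, hidem]
  let φ : (ι → K) →ₗ[K] DeltaQuotient K O L :=
    (Submodule.mkQ _).comp (Fintype.linearCombination K fun i => ⟨e i, hmem i⟩)
  have hker : LinearMap.ker φ ≤ Submodule.span K {fun _ => 1} := by
    intro c hc
    have hc' : ∑ i, c i • e i ∈ baseSpan K O L := by
      have := (Submodule.Quotient.mk_eq_zero _).mp (LinearMap.mem_ker.mp hc)
      rw [Submodule.mem_comap] at this
      simpa [Fintype.linearCombination_apply] using this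
    obtain ⟨a, ha⟩ := mem_baseSpan_iff.mp hc'
    have hae (i : ι) : ¬ IsUnit (a - algebraMap K O (c i)) := by
      intro hu
      refine hne i ((hu.map (algebraMap O L)).mul_right_eq_zero.mp ?_)
      rw [map_sub, ha, sub_mul, Finset.sum_mul, Finset.sum_eq_single i,
        ← IsScalarTower.algebraMap_apply, ← Algebra.smul_def, smul_mul_assoc, hidem, sub_self]
      · intro j _ hj
        rw [smul_mul_assoc, horth j i hj, smul_zero]
      · simp
    have hconst (i j : ι) : c i = c j := by
      by_contra hij
      have hu : IsUnit (algebraMap K O (c j - c i)) :=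
        (IsUnit.mk0 _ (sub_ne_zero.mpr (Ne.symm hij))).map _
      have hsplit : algebraMap K O (c j - c i) =
          (a - algebraMap K O (c i)) + -(a - algebraMap K O (c j)) := by
        rw [map_sub]; ring
      rw [hsplit] at hu
      rcases IsLocalRing.isUnit_or_isUnit_of_isUnit_add hu with h | h
      · exact hae i h
      · exact hae j (by simpa using h.neg)
    rcases isEmpty_or_nonempty ι with hι | ⟨⟨i₀⟩⟩
    · rw [Subsingleton.elim c 0]; exact zero_mem _
    · refine Submodule.mem_span_singleton.mpr ⟨c i₀, ?_⟩
      ext i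
      simp [hconst i i₀]
  have h1 := LinearMap.finrank_range_add_finrank_ker φ
  rw [Module.finrank_fintype_fun_eq_card] at h1
  have h2 := Submodule.finrank_mono hker
  have h3 := finrank_span_le_card (R := K) {fun _ : ι => (1 : K)}
  rw [Set.toFinset_singleton, Finset.card_singleton] at h3
  have h4 := Submodule.finrank_le (LinearMap.range φ)
  omega

end DeltaQuotient

section PlanePowerSeries

open MvPowerSeries

variable {K : Type*} [Field K]

theorem MvPowerSeries.coeff_single_one_mul {σ R : Type*} [CommSemiring R] (i : σ)
    (a b : MvPowerSeries σ R) :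
    coeff (Finsupp.single i 1) (a * b) =
      constantCoeff a * coeff (Finsupp.single i 1) b +
        coeff (Finsupp.single i 1) a * constantCoeff b := by
  classical
  rw [coeff_mul, Finsupp.antidiagonal_single]
  simp [Finset.Nat.antidiagonal_succ]

theorem MvPowerSeries.irreducible_of_coeff_single_ne_zero {σ : Type*} {f : MvPowerSeries σ K}
    (h0 : constantCoeff f = 0) {i : σ} (hi : coeff (Finsupp.single i 1) f ≠ 0) :
    Irreducible f := by
  refine ⟨fun h => ?_, fun a b hab => ?_⟩
  · exact ((MvPowerSeries.isUnit_iff_constantCoeff).mp h).ne_zero h0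
  · rw [MvPowerSeries.isUnit_iff_constantCoeff, MvPowerSeries.isUnit_iff_constantCoeff,
      isUnit_iff_ne_zero, isUnit_iff_ne_zero]
    by_contra! hcon
    rw [hab, coeff_single_one_mul, hcon.1, hcon.2] at hi
    simp at hi

/-- Power series in two variables as power series in the second one over power series in the
first one. -/
def planeEquiv (K : Type*) [Field K] :
    MvPowerSeries (Fin 2) K ≃ₐ[K] PowerSeries (PowerSeries K) :=
  (MvPowerSeries.renameEquiv K (finSuccEquiv' (n := 1) 1|>.trans
    (Equiv.optionCongr (Equiv.ofUnique (Fin 1) Unit)))).trans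
    (MvPowerSeries.optionEquivLeft Unit K)

theorem planeEquiv_X_zero : planeEquiv K (X 0) = PowerSeries.C PowerSeries.X := by
  refine Eq.trans (congrArg (MvPowerSeries.optionEquivLeft Unit K) (rename_X _ 0)) ?_
  exact optionEquivLeft_X_some ()

theorem planeEquiv_X_one : planeEquiv K (X 1) = PowerSeries.X := by
  refine Eq.trans (congrArg (MvPowerSeries.optionEquivLeft Unit K) (rename_X _ 1)) ?_
  exact optionEquivLeft_X_none

theorem exists_eq_X_zero_mul_add_X_one_mul {g : MvPowerSeries (Fin 2) K}
    (hg : constantCoeff g = 0) : ∃ a b, g = X 0 * a + X 1 * b := by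
  have hu : ¬ IsUnit (PowerSeries.constantCoeff (PowerSeries.constantCoeff (planeEquiv K g))) := by
    rw [← PowerSeries.isUnit_iff_constantCoeff, ← PowerSeries.isUnit_iff_constantCoeff,
      MulEquiv.isUnit_map, isUnit_iff_constantCoeff, hg]
    exact not_isUnit_zero
  obtain ⟨a, ha⟩ := PowerSeries.X_dvd_iff.mpr (by simpa using hu)
  obtain ⟨b, hb⟩ : PowerSeries.X ∣
      planeEquiv K g - PowerSeries.C (PowerSeries.constantCoeff (planeEquiv K g)) := by
    rw [PowerSeries.X_dvd_iff, map_sub, PowerSeries.constantCoeff_C, sub_self]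
  refine ⟨(planeEquiv K).symm (PowerSeries.C a), (planeEquiv K).symm b,
    (planeEquiv K).injective ?_⟩
  rw [map_add, map_mul, map_mul, AlgEquiv.apply_symm_apply, AlgEquiv.apply_symm_apply,
    planeEquiv_X_zero, planeEquiv_X_one, ← map_mul, ← ha, ← hb, add_sub_cancel]

instance : IsDomain (MvPowerSeries (Fin 2) K) := NoZeroDivisors.to_isDomain _

instance : UniqueFactorizationMonoid (MvPowerSeries (Fin 2) K) :=
  (planeEquiv K).symm.toMulEquiv.uniqueFactorizationMonoid inferInstance

/-- The shear `x ↦ x + c y`, `y ↦ y`. -/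
def shearFun (c : K) : Fin 2 → MvPowerSeries (Fin 2) K :=
  ![X 0 + c • X 1, X 1]

theorem hasSubst_shearFun (c : K) : HasSubst (shearFun c) :=
  hasSubst_of_constantCoeff_zero fun i => by fin_cases i <;> simp [shearFun]

theorem subst_shearFun_subst_shearFun (c d : K) (hcd : c + d = 0)
    (f : MvPowerSeries (Fin 2) K) : subst (shearFun d) (subst (shearFun c) f) = f := by
  rw [subst_comp_subst_apply (hasSubst_shearFun c) (hasSubst_shearFun d)]
  suffices h : (fun i => subst (shearFun d) (shearFun c i)) = X by
    rw [h, subst_self, id]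
  ext1 i
  have hd := hasSubst_shearFun d
  fin_cases i
  · change subst (shearFun d) (X 0 + c • X 1) = X 0
    rw [subst_add hd, subst_smul hd, subst_X hd, subst_X hd]
    change X 0 + d • X 1 + c • X 1 = X 0
    rw [add_assoc, ← add_smul, add_comm d c, hcd, zero_smul, add_zero]
  · exact subst_X hd 1

/-- The automorphism `f(x, y) ↦ f(x + c y, y)`. -/
def shearEquiv (c : K) : MvPowerSeries (Fin 2) K ≃ₐ[K] MvPowerSeries (Fin 2) K :=
  AlgEquiv.ofAlgHom (substAlgHom (hasSubst_shearFun c)) (substAlgHom (hasSubst_shearFun (-c)))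
    (AlgHom.ext fun f => by
      simpa [coe_substAlgHom] using subst_shearFun_subst_shearFun (-c) c (by simp) f)
    (AlgHom.ext fun f => by
      simpa [coe_substAlgHom] using subst_shearFun_subst_shearFun c (-c) (by simp) f)

theorem shearEquiv_X_zero_sub (c : K) : shearEquiv c (X 0 - c • X 1) = X 0 := by
  change substAlgHom (hasSubst_shearFun c) (X 0 - c • X 1) = X 0
  rw [map_sub, map_smul, substAlgHom_X, substAlgHom_X]
  simp [shearFun]

instance : IsAdicComplete (IsLocalRing.maximalIdeal (PowerSeries K)) (PowerSeries K) := by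
  rw [PowerSeries.maximalIdeal_eq_span_X]
  infer_instance

theorem PowerSeries.C_X_dvd_of_map_residue_eq_zero {g : PowerSeries (PowerSeries K)}
    (h : PowerSeries.map (IsLocalRing.residue (PowerSeries K)) g = 0) :
    PowerSeries.C PowerSeries.X ∣ g := by
  have hdvd (n : ℕ) : (PowerSeries.X : PowerSeries K) ∣ PowerSeries.coeff n g := by
    have hn : IsLocalRing.residue (PowerSeries K) (PowerSeries.coeff n g) = 0 := by
      rw [← PowerSeries.coeff_map, h, map_zero]
    rwa [IsLocalRing.residue_eq_zero_iff, PowerSeries.maximalIdeal_eq_span_X,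
      Ideal.mem_span_singleton] at hn
  choose q hq using hdvd
  refine ⟨PowerSeries.mk q, PowerSeries.ext fun n => ?_⟩
  rw [PowerSeries.coeff_C_mul, PowerSeries.coeff_mk, hq]

theorem PowerSeries.finite_quotientMk_comp_C {A : Type*} [CommRing A] [IsLocalRing A]
    [IsAdicComplete (IsLocalRing.maximalIdeal A) A] {g : PowerSeries A}
    (hg : PowerSeries.map (IsLocalRing.residue A) g ≠ 0) :
    ((Ideal.Quotient.mk (Ideal.span {g})).comp PowerSeries.C).Finite := by
  obtain ⟨p, h, hph⟩ := PowerSeries.exists_isWeierstrassFactorization hg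
  have := hph.isDistinguishedAt.monic.finite_quotient
  have hfin : Module.Finite A (PowerSeries A ⧸ Ideal.span {g}) :=
    Module.Finite.equiv hph.algEquivQuotient.toLinearEquiv
  exact RingHom.finite_algebraMap.mpr hfin

/-- A curve not containing the line `x = c y` is finite over the power series ring in
`x - c y`. -/
theorem exists_finite_algHom {f : MvPowerSeries (Fin 2) K} {c : K}
    (hf : ¬ (X 0 - c • X 1) ∣ f) :
    ∃ ψ : PowerSeries K →ₐ[K] MvPowerSeries (Fin 2) K ⧸ Ideal.span {f},
      ψ.Finite ∧ ψ PowerSeries.X = Ideal.Quotient.mk _ (X 0 - c • X 1) := by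
  let Φ := (shearEquiv c).trans (planeEquiv K)
  have hΦ : Φ (X 0 - c • X 1) = PowerSeries.C PowerSeries.X :=
    (congrArg (planeEquiv K) (shearEquiv_X_zero_sub c)).trans planeEquiv_X_zero
  have hres : PowerSeries.map (IsLocalRing.residue (PowerSeries K)) (Φ f) ≠ 0 := fun h =>
    hf ((map_dvd_iff Φ).mp (hΦ ▸ PowerSeries.C_X_dvd_of_map_residue_eq_zero h))
  let e : (PowerSeries (PowerSeries K) ⧸ Ideal.span {Φ f}) ≃ₐ[K]
      (MvPowerSeries (Fin 2) K ⧸ Ideal.span {f}) :=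
    Ideal.quotientEquivAlg _ _ Φ.symm (by rw [Ideal.map_span]; simp)
  let ι : PowerSeries K →ₐ[K] PowerSeries (PowerSeries K) ⧸ Ideal.span {Φ f} :=
    { (Ideal.Quotient.mk (Ideal.span {Φ f})).comp PowerSeries.C with
      commutes' := fun r => congrArg (Ideal.Quotient.mk (Ideal.span {Φ f}))
        (PowerSeries.algebraMap_apply (R := K) (A := PowerSeries K)).symm }
  refine ⟨e.toAlgHom.comp ι, ?_, ?_⟩
  · exact RingHom.Finite.comp (RingHom.Finite.of_surjective _ e.surjective)
      (PowerSeries.finite_quotientMk_comp_C hres)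
  · change Ideal.Quotient.mk _ (Φ.symm (PowerSeries.C PowerSeries.X)) = _
    rw [← hΦ, AlgEquiv.symm_apply_apply]

end PlanePowerSeries

section IrreducibleFactors

variable {R : Type*} [CommRing R] [IsDomain R] [UniqueFactorizationMonoid R]

theorem Squarefree.dvd_of_forall_irreducible_dvd {g h : R} (hg : Squarefree g)
    (H : ∀ p, Irreducible p → p ∣ g → p ∣ h) : g ∣ h := by
  induction g using WfDvdMonoid.induction_on_irreducible with
  | zero => exact absurd hg not_squarefree_zero
  | unit u hu => exact hu.dvd
  | mul a i ha hi ih =>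
    obtain ⟨k, rfl⟩ := ih (hg.of_mul_right) fun p hp hpa => H p hp (hpa.mul_left i)
    have hia : ¬ i ∣ a := fun hia => hi.not_isUnit (hg i (mul_dvd_mul_left i hia))
    obtain ⟨m, rfl⟩ := (hi.prime.dvd_or_dvd (H i hi (dvd_mul_right i a))).resolve_left hia
    exact ⟨m, by ring⟩

theorem finite_setOf_irreducible_dvd_mk {f : R} (hf : f ≠ 0) :
    {P : Associates R | Irreducible P ∧ P ∣ Associates.mk f}.Finite := by
  obtain ⟨s, hs, hsf⟩ := UniqueFactorizationMonoid.exists_prime_factors f hf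
  refine (s.toFinset.finite_toSet.image Associates.mk).subset ?_
  rintro ⟨p⟩ ⟨hP, hPf⟩
  have hp : Irreducible p := Associates.irreducible_mk.mp hP
  have hpf : p ∣ s.prod := (Associates.mk_dvd_mk.mp hPf).trans hsf.symm.dvd
  obtain ⟨q, hq, hpq⟩ := hp.prime.exists_mem_multiset_dvd hpf
  refine ⟨q, by simpa using hq, ?_⟩
  exact Associates.mk_eq_mk_iff_associated.mpr
    (hp.associated_of_dvd (hs q hq).irreducible hpq).symm

/-- The total fraction ring of `R ⧸ (f)` contains one nonzero idempotent for each irreducible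
factor of the squarefree element `f`, and these are orthogonal. -/
theorem exists_orthogonal_idempotents {f : R} (hf : Squarefree f) (L : Type*) [CommRing L]
    [Algebra (R ⧸ Ideal.span {f}) L] [IsFractionRing (R ⧸ Ideal.span {f}) L] :
    ∃ e : {P : Associates R | Irreducible P ∧ P ∣ Associates.mk f} → L,
      (∀ P, e P * e P = e P) ∧ (∀ P P', P ≠ P' → e P * e P' = 0) ∧ ∀ P, e P ≠ 0 := by
  set T := {P : Associates R | Irreducible P ∧ P ∣ Associates.mk f}
  have : Fintype T := (finite_setOf_irreducible_dvd_mk hf.ne_zero).fintype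
  have hrep (P : T) : ∃ p : R, Associates.mk p = P := Associates.mk_surjective P.1
  choose p hp using hrep
  have hirr (P : T) : Irreducible (p P) := Associates.irreducible_mk.mp (hp P ▸ P.2.1)
  have hdvd (P : T) : p P ∣ f := Associates.mk_dvd_mk.mp (hp P ▸ P.2.2)
  choose Q hQ using hdvd
  have hQP (P : T) : ¬ p P ∣ Q P := fun h =>
    (hirr P).not_isUnit (hf _ (hQ P ▸ mul_dvd_mul_left (p P) h))
  have hQP' (P P' : T) (h : P ≠ P') : p P ∣ Q P' := by
    have hdvd : p P ∣ p P' * Q P' := hQ P' ▸ ⟨Q P, hQ P⟩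
    refine ((hirr P).prime.dvd_or_dvd hdvd).resolve_left fun hPP => h (Subtype.ext ?_)
    rw [← hp P, ← hp P']
    exact Associates.mk_eq_mk_iff_associated.mpr ((hirr P).associated_of_dvd (hirr P') hPP)
  let a : R →+* L := (algebraMap (R ⧸ Ideal.span {f}) L).comp (Ideal.Quotient.mk _)
  have ha (g : R) : a g = 0 ↔ f ∣ g := by
    rw [← Ideal.mem_span_singleton, ← Ideal.Quotient.eq_zero_iff_mem]
    exact map_eq_zero_iff _ (IsFractionRing.injective _ L)
  have horth (P P' : T) (h : P ≠ P') : a (Q P) * a (Q P') = 0 := by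
    obtain ⟨m, hm⟩ := hQP' P' P h.symm
    rw [← map_mul, ha]
    exact ⟨m, by rw [hm, hQ P']; ring⟩
  have hs : Ideal.Quotient.mk (Ideal.span {f}) (∑ P, Q P) ∈
      nonZeroDivisors (R ⧸ Ideal.span {f}) := by
    refine mem_nonZeroDivisors_iff_right.mpr fun z hz => ?_
    obtain ⟨h, rfl⟩ := Ideal.Quotient.mk_surjective z
    rw [← map_mul, Ideal.Quotient.eq_zero_iff_mem, Ideal.mem_span_singleton] at hz
    rw [Ideal.Quotient.eq_zero_iff_mem, Ideal.mem_span_singleton]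
    refine hf.dvd_of_forall_irreducible_dvd fun q hq hqf => ?_
    let P : T := ⟨Associates.mk q, Associates.irreducible_mk.mpr hq, Associates.mk_dvd_mk.mpr hqf⟩
    have hPq : Associated (p P) q := Associates.mk_eq_mk_iff_associated.mp (hp P)
    refine hPq.dvd_iff_dvd_left.mp (((hirr P).prime.dvd_or_dvd ?_).resolve_right (hQP P))
    have hPs : p P ∣ ∑ P', Q P' - Q P := by
      rw [← Finset.add_sum_erase _ _ (Finset.mem_univ P), add_sub_cancel_left]
      exact Finset.dvd_sum fun P' hP' => hQP' P P' (Finset.ne_of_mem_erase hP').symm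
    have hPf : p P ∣ h * ∑ P', Q P' := (hPq.dvd.trans hqf).trans hz
    have := dvd_sub hPf (hPs.mul_left h)
    rwa [mul_sub, sub_sub_cancel] at this
  obtain ⟨v, hv⟩ := (IsLocalization.map_units L ⟨_, hs⟩).exists_left_inv
  replace hv : v * ∑ P, a (Q P) = 1 := by
    rw [← map_sum]
    exact hv
  have hsq (P : T) : a (Q P) * ∑ P', a (Q P') = a (Q P) * a (Q P) := by
    rw [Finset.mul_sum]
    exact Finset.sum_eq_single P (fun P' _ h => horth P P' h.symm) (by simp)
  refine ⟨fun P => a (Q P) * v, fun P => ?_, fun P P' h => ?_, fun P h => ?_⟩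
  · calc a (Q P) * v * (a (Q P) * v) = a (Q P) * a (Q P) * v * v := by ring
      _ = a (Q P) * v * (v * ∑ P', a (Q P')) := by rw [← hsq]; ring
      _ = a (Q P) * v := by rw [hv, mul_one]
  · calc a (Q P) * v * (a (Q P') * v) = a (Q P) * a (Q P') * (v * v) := by ring
      _ = 0 := by rw [horth P P' h, zero_mul]
  · have h0 : a (Q P) = 0 := by
      rw [← mul_one (a (Q P)), ← hv, ← mul_assoc, show a (Q P) * v = 0 from h, zero_mul]
    exact hQP P ((Dvd.intro _ (hQ P).symm).trans ((ha _).mp h0))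

end IrreducibleFactors

namespace PlaneCurveNote

section CurveRing

open MvPowerSeries

variable {K : Type u} [Field K] {f : PS K}

theorem coeff_single_zero_line (c : K) :
    coeff (Finsupp.single 0 1) (X 0 - c • X 1 : PS K) = 1 := by
  simp [coeff_X, Finsupp.single_left_inj]

theorem coeff_single_one_line (c : K) :
    coeff (Finsupp.single 1 1) (X 0 - c • X 1 : PS K) = -c := by
  simp [coeff_X, Finsupp.single_left_inj]

theorem constantCoeff_line (c : K) : constantCoeff (X 0 - c • X 1 : PS K) = 0 := by
  rw [map_sub, constantCoeff_smul, constantCoeff_X, constantCoeff_X, smul_zero, sub_zero]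

theorem irreducible_line (c : K) : Irreducible (X 0 - c • X 1 : PS K) :=
  irreducible_of_coeff_single_ne_zero (constantCoeff_line c) (i := 0)
    (by rw [coeff_single_zero_line]; exact one_ne_zero)

theorem exists_line_not_dvd [Infinite K] (hf : f ≠ 0) : ∃ c : K, ¬ (X 0 - c • X 1) ∣ f := by
  by_contra! h
  refine Set.infinite_of_injective_forall_mem (f := fun c : K => Associates.mk (X 0 - c • X 1))
    (fun c d hcd => ?_) (fun c => ?_) (finite_setOf_irreducible_dvd_mk hf)
  · obtain ⟨u, hu⟩ := Associates.mk_eq_mk_iff_associated.mp hcd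
    have h0 := congrArg (coeff (Finsupp.single 0 1)) hu
    have h1 := congrArg (coeff (Finsupp.single 1 1)) hu
    rw [coeff_single_one_mul, constantCoeff_line, zero_mul, zero_add] at h0 h1
    rw [coeff_single_zero_line, coeff_single_zero_line, one_mul] at h0
    rw [coeff_single_one_line, coeff_single_one_line, h0, mul_one] at h1
    exact neg_injective h1
  · exact ⟨Associates.irreducible_mk.mpr (irreducible_line c), Associates.mk_dvd_mk.mpr (h c)⟩

/-- The value at the origin, on the local ring of a curve through the origin. -/
def curveEval (h0 : constantCoeff f = 0) : CurveRing K f →+* K :=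
  Ideal.Quotient.lift _ constantCoeff fun a ha => by
    obtain ⟨b, rfl⟩ := Ideal.mem_span_singleton.mp ha
    rw [map_mul, h0, zero_mul]

theorem curveEval_mk (h0 : constantCoeff f = 0) (g : PS K) :
    curveEval h0 (Ideal.Quotient.mk _ g) = constantCoeff g := rfl

theorem isLocalRing_curveRing (h0 : constantCoeff f = 0) : IsLocalRing (CurveRing K f) :=
  have := (curveEval h0).domain_nontrivial
  IsLocalRing.of_surjective' (Ideal.Quotient.mk _) Ideal.Quotient.mk_surjective

theorem isReduced_curveRing (hf : Squarefree f) : IsReduced (CurveRing K f) :=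
  (Ideal.isRadical_iff_quotient_reduced _).mp (isRadical_iff_span_singleton.mp hf.isRadical)

theorem exists_finite_algHom_nonZeroDivisor [Infinite K] (hf : f ≠ 0)
    (h0 : constantCoeff f = 0) : ∃ ψ : PowerSeries K →ₐ[K] CurveRing K f,
      ψ.Finite ∧ ψ PowerSeries.X ∈ nonZeroDivisors (CurveRing K f) ∧
        ¬ IsUnit (ψ PowerSeries.X) := by
  obtain ⟨c, hc⟩ := exists_line_not_dvd hf
  obtain ⟨ψ, hψ, hψX⟩ := exists_finite_algHom hc
  refine ⟨ψ, hψ, ?_, fun hu => ?_⟩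
  · rw [hψX]
    refine mem_nonZeroDivisors_iff_right.mpr fun z hz => ?_
    obtain ⟨h, rfl⟩ := Ideal.Quotient.mk_surjective z
    rw [← map_mul, Ideal.Quotient.eq_zero_iff_mem, Ideal.mem_span_singleton] at hz
    rw [Ideal.Quotient.eq_zero_iff_mem, Ideal.mem_span_singleton]
    obtain ⟨g, hg⟩ := hz
    have hl := (irreducible_line c).prime
    obtain ⟨m, rfl⟩ := (hl.dvd_or_dvd (hg ▸ dvd_mul_left _ h)).resolve_left hc
    exact ⟨m, mul_right_cancel₀ hl.ne_zero (by rw [hg]; ring)⟩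
  · have := hu.map (curveEval h0)
    rw [hψX, curveEval_mk, constantCoeff_line] at this
    exact not_isUnit_zero this

theorem finite_deltaQuotient_curveRing [Infinite K] (hf : Squarefree f)
    (h0 : constantCoeff f = 0) (L : Type*) [CommRing L] [Algebra K L] [Algebra (CurveRing K f) L]
    [IsScalarTower K (CurveRing K f) L] [IsFractionRing (CurveRing K f) L] :
    Module.Finite K (DeltaQuotient K (CurveRing K f) L) := by
  obtain ⟨ψ, hψ, hX, hX'⟩ := exists_finite_algHom_nonZeroDivisor hf.ne_zero h0
  let _ := ψ.toAlgebra
  have : Module.Finite (PowerSeries K) (CurveRing K f) := hψ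
  have : IsScalarTower K (PowerSeries K) (CurveRing K f) :=
    IsScalarTower.of_algebraMap_eq fun r => (ψ.commutes r).symm
  have := isLocalRing_curveRing h0
  have := isReduced_curveRing hf
  obtain ⟨S, hS, hle⟩ := exists_finite_le_span_sup_range (K := K) (O := CurveRing K f) (L := L)
    hX hX'
  exact finite_deltaQuotient hS hle

theorem delta_eq (f : PS K) : delta K f =
    Module.finrank K (DeltaQuotient K (CurveRing K f) (FractionRing (CurveRing K f))) := by
  have hmem : deltaSpec K f
      (Module.finrank K (DeltaQuotient K (CurveRing K f) (FractionRing (CurveRing K f)))) := by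
    intro L _ _ _ _ _
    exact finrank_deltaQuotient_congr (IsLocalization.algEquiv (nonZeroDivisors _) _ L)
  have hdelta : deltaSpec K f (delta K f) := Nat.sInf_mem (s := {d | deltaSpec K f d}) ⟨_, hmem⟩
  exact hdelta (FractionRing (CurveRing K f))

theorem numFactors_le_delta_add_one [Infinite K] (hf : Squarefree f)
    (h0 : constantCoeff f = 0) : numFactors K f ≤ delta K f + 1 := by
  obtain ⟨e, he, he', hne⟩ := exists_orthogonal_idempotents hf (FractionRing (CurveRing K f))
  have : Fintype {P : Associates (PS K) | Irreducible P ∧ P ∣ Associates.mk f} :=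
    (finite_setOf_irreducible_dvd_mk hf.ne_zero).fintype
  have := isLocalRing_curveRing h0
  have := finite_deltaQuotient_curveRing hf h0 (FractionRing (CurveRing K f))
  rw [delta_eq, numFactors, Set.ncard_eq_toFinset_card', Set.toFinset_card]
  exact card_le_finrank_deltaQuotient_add_one e he he' hne

theorem numFactors_eq_one_of_irreducible (hf : Irreducible f) : numFactors K f = 1 := by
  refine Set.ncard_eq_one.mpr ⟨Associates.mk f, Set.eq_singleton_iff_unique_mem.mpr
    ⟨⟨Associates.irreducible_mk.mpr hf, dvd_rfl⟩, ?_⟩⟩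
  rintro P ⟨hP, hPf⟩
  exact associated_iff_eq.mp (hP.associated_of_dvd (Associates.irreducible_mk.mpr hf) hPf)

theorem irreducible_of_numFactors_le_one (hf : Squarefree f) (h0 : constantCoeff f = 0)
    (h : numFactors K f ≤ 1) : Irreducible f := by
  have hu : ¬ IsUnit f := fun h => (isUnit_iff_constantCoeff.mp h).ne_zero h0
  obtain ⟨p, hp, q, rfl⟩ := WfDvdMonoid.exists_irreducible_factor hu hf.ne_zero
  have hq : IsUnit q := by
    by_contra hq
    obtain ⟨p', hp', hp'q⟩ := WfDvdMonoid.exists_irreducible_factor hq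
      (right_ne_zero_of_mul hf.ne_zero)
    have hpp' : Associates.mk p = Associates.mk p' :=
      (Set.ncard_le_one (finite_setOf_irreducible_dvd_mk hf.ne_zero)).mp h _
        ⟨Associates.irreducible_mk.mpr hp, Associates.mk_dvd_mk.mpr (dvd_mul_right p q)⟩ _
        ⟨Associates.irreducible_mk.mpr hp', Associates.mk_dvd_mk.mpr (hp'q.mul_left p)⟩
    have hpq : p ∣ q := (Associates.mk_eq_mk_iff_associated.mp hpp').dvd.trans hp'q
    exact hp.not_isUnit (hf p (mul_dvd_mul_left p hpq))
  exact (irreducible_mul_isUnit hq).mpr hp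

theorem isDomain_curveRing (hf : Irreducible f) : IsDomain (CurveRing K f) :=
  have := (Ideal.span_singleton_prime hf.ne_zero).mpr hf.prime
  Ideal.Quotient.isDomain _

theorem isMaximal_of_isPrime_of_ne_bot [Infinite K] (hf : Irreducible f)
    (h0 : constantCoeff f = 0) (q : Ideal (CurveRing K f)) (hq : q ≠ ⊥) [q.IsPrime] :
    q.IsMaximal := by
  obtain ⟨ψ, hψ, hX, hX'⟩ := exists_finite_algHom_nonZeroDivisor hf.ne_zero h0
  let _ := ψ.toAlgebra
  have : Module.Finite (PowerSeries K) (CurveRing K f) := hψ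
  have := isDomain_curveRing hf
  obtain ⟨u, hu, hu0⟩ := Submodule.exists_mem_ne_zero_of_ne_bot hq
  obtain ⟨m, v, hv⟩ := exists_algebraMap_X_pow_mul_eq_sq_mul (K := K) u
  have hm : algebraMap (PowerSeries K) (CurveRing K f) PowerSeries.X ^ m = u * v :=
    mul_right_cancel₀ hu0 (hv.trans (by ring))
  have hXq : algebraMap (PowerSeries K) (CurveRing K f) PowerSeries.X ∈ q :=
    Ideal.IsPrime.mem_of_pow_mem inferInstance m (hm ▸ q.mul_mem_right v hu)
  refine Ideal.isMaximal_of_isIntegral_of_isMaximal_comap (R := PowerSeries K) q ?_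
  have hle : IsLocalRing.maximalIdeal (PowerSeries K) ≤
      q.comap (algebraMap (PowerSeries K) (CurveRing K f)) := by
    rw [PowerSeries.maximalIdeal_eq_span_X, Ideal.span_singleton_le_iff_mem]
    exact hXq
  rw [← (IsLocalRing.maximalIdeal.isMaximal _).eq_of_le Ideal.IsPrime.ne_top' hle]
  infer_instance

theorem isUnit_mk_iff (h0 : constantCoeff f = 0) (g : PS K) :
    IsUnit (Ideal.Quotient.mk (Ideal.span {f}) g) ↔ constantCoeff g ≠ 0 := by
  rw [← isUnit_iff_ne_zero]
  exact ⟨fun h => h.map (curveEval h0), fun h => (isUnit_iff_constantCoeff.mpr h).map _⟩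

theorem isPrincipal_maximalIdeal_of_dvd (h0 : constantCoeff f = 0) [IsLocalRing (CurveRing K f)]
    {t : PS K} (ht : constantCoeff t = 0)
    (h : ∀ i : Fin 2, Ideal.Quotient.mk (Ideal.span {f}) t ∣ Ideal.Quotient.mk _ (X i)) :
    (IsLocalRing.maximalIdeal (CurveRing K f)).IsPrincipal := by
  refine ⟨Ideal.Quotient.mk _ t, le_antisymm (fun z hz => ?_) ?_⟩
  · obtain ⟨g, rfl⟩ := Ideal.Quotient.mk_surjective z
    rw [IsLocalRing.mem_maximalIdeal, mem_nonunits_iff, isUnit_mk_iff h0, not_not] at hz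
    obtain ⟨a, b, rfl⟩ := exists_eq_X_zero_mul_add_X_one_mul hz
    rw [map_add, map_mul, map_mul]
    exact Ideal.mem_span_singleton.mpr
      (dvd_add ((h 0).mul_right _) ((h 1).mul_right _))
  · refine (Ideal.span_singleton_le_iff_mem _).mpr ?_
    rw [IsLocalRing.mem_maximalIdeal, mem_nonunits_iff, isUnit_mk_iff h0, not_not]
    exact ht

theorem isPrincipal_maximalIdeal_of_coeff_ne_zero (h0 : constantCoeff f = 0)
    [IsLocalRing (CurveRing K f)] {i : Fin 2} (hi : coeff (Finsupp.single i 1) f ≠ 0) :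
    (IsLocalRing.maximalIdeal (CurveRing K f)).IsPrincipal := by
  obtain ⟨a, b, hab⟩ := exists_eq_X_zero_mul_add_X_one_mul h0
  let π := Ideal.Quotient.mk (Ideal.span {f})
  have hπ : π (X 0) * π a + π (X 1) * π b = 0 := by
    rw [← map_mul, ← map_mul, ← map_add, ← hab]
    exact Ideal.Quotient.eq_zero_iff_mem.mpr (Ideal.mem_span_singleton_self f)
  rw [hab, map_add, coeff_single_one_mul, coeff_single_one_mul, constantCoeff_X,
    constantCoeff_X, zero_mul, zero_mul, zero_add, zero_add] at hi
  fin_cases i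
  · have ha : IsUnit (π a) := by
      rw [isUnit_mk_iff h0]
      simpa [coeff_X, Finsupp.single_left_inj] using hi
    refine isPrincipal_maximalIdeal_of_dvd h0 (t := X 1) (constantCoeff_X 1) fun j => ?_
    fin_cases j
    · change π (X 1) ∣ π (X 0)
      exact ha.dvd_mul_right.mp ⟨-π b, by linear_combination hπ⟩
    · exact dvd_rfl
  · have hb : IsUnit (π b) := by
      rw [isUnit_mk_iff h0]
      simpa [coeff_X, Finsupp.single_left_inj] using hi
    refine isPrincipal_maximalIdeal_of_dvd h0 (t := X 0) (constantCoeff_X 0) fun j => ?_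
    fin_cases j
    · exact dvd_rfl
    · change π (X 0) ∣ π (X 1)
      exact hb.dvd_mul_right.mp ⟨-π a, by linear_combination hπ⟩

theorem exists_coeff_ne_zero_of_isPrincipal_maximalIdeal (h0 : constantCoeff f = 0)
    [IsLocalRing (CurveRing K f)] (h : (IsLocalRing.maximalIdeal (CurveRing K f)).IsPrincipal) :
    ∃ i : Fin 2, coeff (Finsupp.single i 1) f ≠ 0 := by
  by_contra! hf
  obtain ⟨τ, hτ⟩ := h
  obtain ⟨t, rfl⟩ := Ideal.Quotient.mk_surjective τ
  have ht : constantCoeff t = 0 := by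
    have := hτ.ge (Ideal.mem_span_singleton_self _)
    rwa [IsLocalRing.mem_maximalIdeal, mem_nonunits_iff, isUnit_mk_iff h0, not_not] at this
  have hX (i : Fin 2) : ∃ k : K, ∀ j, coeff (Finsupp.single j 1) (X i : PS K) =
      coeff (Finsupp.single j 1) t * k := by
    have hi : Ideal.Quotient.mk (Ideal.span {f}) (X i) ∈
        IsLocalRing.maximalIdeal (CurveRing K f) := by
      rw [IsLocalRing.mem_maximalIdeal, mem_nonunits_iff, isUnit_mk_iff h0, not_not]
      exact constantCoeff_X i
    obtain ⟨z, hz⟩ := Ideal.mem_span_singleton.mp (hτ.le hi)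
    obtain ⟨s, rfl⟩ := Ideal.Quotient.mk_surjective z
    rw [← map_mul, Ideal.Quotient.eq, Ideal.mem_span_singleton] at hz
    obtain ⟨g, hg⟩ := hz
    refine ⟨constantCoeff s, fun j => ?_⟩
    rw [sub_eq_iff_eq_add.mp hg, map_add, coeff_single_one_mul, coeff_single_one_mul, ht, h0,
      hf j]
    ring
  obtain ⟨k, hk⟩ := hX 0
  obtain ⟨l, hl⟩ := hX 1
  have h00 := hk 0
  have h01 := hk 1
  have h11 := hl 1
  simp only [coeff_X, Finsupp.single_left_inj one_ne_zero] at h00 h01 h11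
  simp only [if_true, one_ne_zero, if_false] at h00 h01 h11
  rcases mul_eq_zero.mp h01.symm with h | h <;> simp [h] at h00 h11

theorem isPrincipal_maximalIdeal_iff {R : Type*} [CommRing R] [IsNoetherianRing R] [IsLocalRing R]
    [IsDomain R] : (IsLocalRing.maximalIdeal R).IsPrincipal ↔
      IsIntegrallyClosed R ∧ ∀ P : Ideal R, P ≠ ⊥ → P.IsPrime → P = IsLocalRing.maximalIdeal R :=
  (tfae_of_isNoetherianRing_of_isLocalRing_of_isDomain R).out 4 3

theorem muBar_eq_zero_of_coeff_ne_zero (h0 : constantCoeff f = 0) {i : Fin 2}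
    (hi : coeff (Finsupp.single i 1) f ≠ 0) : muBar K f = 0 := by
  have hf := irreducible_of_coeff_single_ne_zero h0 hi
  have := isDomain_curveRing hf
  have := isLocalRing_curveRing h0
  have hclosed : IsIntegrallyClosed (CurveRing K f) :=
    (isPrincipal_maximalIdeal_iff.mp (isPrincipal_maximalIdeal_of_coeff_ne_zero h0 hi)).1
  have hdelta : delta K f = 0 := by
    rw [delta_eq]
    exact finrank_deltaQuotient_eq_zero fun b hb =>
      (isIntegrallyClosed_iff (FractionRing (CurveRing K f))).mp hclosed hb
  rw [muBar, hdelta, numFactors_eq_one_of_irreducible hf]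
  norm_num

theorem delta_pos_of_coeff_eq_zero [Infinite K] (hf : Squarefree f) (h0 : constantCoeff f = 0)
    (h : ∀ i : Fin 2, coeff (Finsupp.single i 1) f = 0) : 0 < delta K f := by
  refine Nat.pos_of_ne_zero fun hdelta => ?_
  have hirr : Irreducible f := irreducible_of_numFactors_le_one hf h0
    (by simpa [hdelta] using numFactors_le_delta_add_one hf h0)
  have := isDomain_curveRing hirr
  have := isLocalRing_curveRing h0
  have := finite_deltaQuotient_curveRing hf h0 (FractionRing (CurveRing K f))
  rw [delta_eq, finrank_deltaQuotient_eq_zero_iff] at hdelta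
  have hclosed : IsIntegrallyClosed (CurveRing K f) :=
    (isIntegrallyClosed_iff (FractionRing (CurveRing K f))).mpr fun {x} hx => hdelta x hx
  obtain ⟨i, hi⟩ := exists_coeff_ne_zero_of_isPrincipal_maximalIdeal h0
    (isPrincipal_maximalIdeal_iff.mpr ⟨hclosed, fun q hq _ =>
      IsLocalRing.eq_maximalIdeal (isMaximal_of_isPrime_of_ne_bot hirr h0 q hq)⟩)
  exact hi (h i)

theorem ordSeries_eq_one_iff (h0 : constantCoeff f = 0) :
    ordSeries K f = 1 ↔ ∃ i : Fin 2, coeff (Finsupp.single i 1) f ≠ 0 := by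
  have hmem (p : ℕ × ℕ) : p ∈ supp K f ↔
      coeff (Finsupp.single 0 p.1 + Finsupp.single 1 p.2) f ≠ 0 := Iff.rfl
  constructor
  · intro h
    obtain ⟨⟨a, b⟩, hab, hsum⟩ := Nat.sInf_mem (Nat.nonempty_of_sInf_eq_succ h)
    replace hsum : a + b = 1 := hsum.trans h
    rw [hmem] at hab
    obtain ⟨rfl, rfl⟩ | ⟨rfl, rfl⟩ := Nat.add_eq_one_iff.mp hsum
    · exact ⟨1, by simpa using hab⟩
    · exact ⟨0, by simpa using hab⟩
  · rintro ⟨i, hi⟩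
    have hone : 1 ∈ (fun p : ℕ × ℕ => p.1 + p.2) '' supp K f := by
      fin_cases i
      · exact ⟨(1, 0), (hmem _).mpr (by simpa using hi), rfl⟩
      · exact ⟨(0, 1), (hmem _).mpr (by simpa using hi), rfl⟩
    refine le_antisymm (Nat.sInf_le hone) (Nat.one_le_iff_ne_zero.mpr fun h => ?_)
    obtain ⟨⟨a, b⟩, hab, hsum⟩ := Nat.sInf_mem ⟨1, hone⟩
    obtain ⟨rfl, rfl⟩ := Nat.add_eq_zero_iff.mp (hsum.trans h)
    rw [hmem] at hab
    simp [h0] at hab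

end CurveRing

theorem muBar_nonneg_and_eq_zero_iff (K : Type u) [Field K] [IsAlgClosed K]
    (f : PS K) (hf : IsReducedSeries K f) :
    0 ≤ muBar K f ∧ (muBar K f = 0 ↔ ordSeries K f = 1) := by
  obtain ⟨-, h0, hsq⟩ := hf
  rw [ordSeries_eq_one_iff h0]
  by_cases h : ∃ i : Fin 2, MvPowerSeries.coeff (Finsupp.single i 1) f ≠ 0
  · obtain ⟨i, hi⟩ := h
    have hmu := muBar_eq_zero_of_coeff_ne_zero h0 hi
    exact ⟨hmu.ge, iff_of_true hmu ⟨i, hi⟩⟩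
  · have hmu : 0 < muBar K f := by
      have hdelta := delta_pos_of_coeff_eq_zero hsq h0 (by simpa using h)
      have hle := numFactors_le_delta_add_one hsq h0
      rw [muBar]
      omega
    exact ⟨hmu.le, iff_of_false hmu.ne' h⟩

end PlaneCurveNote
end
end

section
/- Let K be an algebraically closed field and let f = g₁⋯g_s ∈ K[[x,y]] be a reduced power series without constant term, where the g_i ∈ K[[x,y]] are pairwise coprime. Then μ̄(f) + s − 1 = Σ_{i=1}^{s} μ̄(g_i) + 2 Σ_{1≤i<j≤s} i₀(g_i, g_j). -/
/-!
Common definitions for formalizing "A note on the plane curve singularities in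
positive characteristic" by E. García Barroso and A. Płoski.

We work with the ring `K[[x,y]] := MvPowerSeries (Fin 2) K`, where `x` is the
variable of index `0` and `y` the variable of index `1`.
-/

open scoped Classical

noncomputable section

universe u

namespace PlaneCurveNote

variable (K : Type u) [Field K]

section PowerSeriesRing

instance isPrincipalIdealRing_mvPowerSeries_fin_one :
    IsPrincipalIdealRing (MvPowerSeries (Fin 1) K) :=
  IsPrincipalIdealRing.of_surjective
    (MvPowerSeries.renameEquiv K (Equiv.equivPUnit.{1, 1} (Fin 1)).symm :
      PowerSeries K ≃ₐ[K] MvPowerSeries (Fin 1) K)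
    (AlgEquiv.surjective _)

instance uniqueFactorizationMonoid_PS : UniqueFactorizationMonoid (PS K) :=
  have : IsDomain (MvPowerSeries (Fin 1) K) := NoZeroDivisors.to_isDomain _
  (MvPowerSeries.finSuccEquiv K 1).symm.toMulEquiv.uniqueFactorizationMonoid inferInstance

variable {K}

/-- A prime ideal of `K[[x,y]]` which does not contain `x` is principal. -/
theorem exists_eq_span_singleton_of_X_zero_notMem (P : Ideal (PS K)) [P.IsPrime]
    (h : MvPowerSeries.X 0 ∉ P) : ∃ q, P = Ideal.span {q} := by
  let e := MvPowerSeries.finSuccEquiv K 1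
  let Q : Ideal (PowerSeries (MvPowerSeries (Fin 1) K)) := P.comap e.symm
  have hX : PowerSeries.X ∉ Q := by
    intro hX
    apply h
    have he : e.symm PowerSeries.X = MvPowerSeries.X 0 := by
      rw [AlgEquiv.symm_apply_eq, MvPowerSeries.finSuccEquiv_X_zero]
    rwa [Ideal.mem_comap, he] at hX
  obtain ⟨a, ha⟩ := (IsPrincipalIdealRing.principal (Q.map PowerSeries.constantCoeff)).principal
  obtain ⟨T, hT, -, hcard⟩ := PowerSeries.exist_eq_span_eq_ncard_of_X_notMem hX ha.symm
    (Set.finite_singleton _)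
  simp only [Set.ncard_singleton, Set.ncard_eq_one] at hcard
  obtain ⟨q, rfl⟩ := hcard
  refine ⟨e.symm q, le_antisymm (fun p hp => ?_) ?_⟩
  · have : e p ∈ Q := by simpa [Q, Ideal.mem_comap] using hp
    rw [hT, Ideal.mem_span_singleton] at this
    obtain ⟨c, hc⟩ := this
    rw [Ideal.mem_span_singleton]
    exact ⟨e.symm c, by rw [← map_mul, ← hc, AlgEquiv.symm_apply_apply]⟩
  · rw [Ideal.span_singleton_le_iff_mem]
    have : q ∈ Q := hT ▸ Ideal.mem_span_singleton_self q
    simpa [Q, Ideal.mem_comap] using this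

/-- A prime ideal of `K[[x,y]]` which does not contain some variable is principal. -/
theorem exists_eq_span_singleton_of_X_notMem (P : Ideal (PS K)) [P.IsPrime] (i : Fin 2)
    (h : MvPowerSeries.X i ∉ P) : ∃ q, P = Ideal.span {q} := by
  let e := MvPowerSeries.renameEquiv K (Equiv.swap 0 i)
  have he : e.symm (MvPowerSeries.X 0) = (MvPowerSeries.X i : PS K) := by
    simp [e]
  obtain ⟨q, hq⟩ := exists_eq_span_singleton_of_X_zero_notMem (P.comap e.symm)
    (by rwa [Ideal.mem_comap, he])
  refine ⟨e.symm q, ?_⟩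
  rw [← Ideal.map_comap_of_surjective e.symm e.symm.surjective P, hq, Ideal.map_span,
    Set.image_singleton]

theorem X_mem_radical_of_isRelPrime {g h : PS K} (hgh : IsRelPrime g h) (i : Fin 2) :
    (MvPowerSeries.X i : PS K) ∈ (Ideal.span ({g, h} : Set (PS K))).radical := by
  rw [Ideal.radical_eq_sInf, Submodule.mem_sInf]
  rintro P ⟨hP, hPprime⟩
  by_contra hX
  obtain ⟨q, rfl⟩ := exists_eq_span_singleton_of_X_notMem P i hX
  refine hPprime.ne_top (Ideal.span_singleton_eq_top.mpr (hgh ?_ ?_)) <;>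
  exact Ideal.mem_span_singleton.mp (hP (Ideal.subset_span (by simp)))

theorem finite_of_ker_le {V W U : Type*} [AddCommGroup V] [Module K V] [AddCommGroup W] [Module K W]
    [AddCommGroup U] [Module K U] [Module.Finite K U] (f : V →ₗ[K] W)
    (hf : Function.Surjective f) (g : V →ₗ[K] U) (h : LinearMap.ker g ≤ LinearMap.ker f) :
    Module.Finite K W := by
  have : Module.Finite K (V ⧸ LinearMap.ker g) := Module.Finite.equiv g.quotKerEquivRange.symm
  refine Module.Finite.of_surjective ((LinearMap.ker g).liftQ f h) fun w => ?_
  obtain ⟨v, rfl⟩ := hf w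
  exact ⟨Submodule.Quotient.mk v, by simp⟩

theorem mem_span_X_pow_of_coeff_eq_zero {n : ℕ} {p : PS K}
    (hp : ∀ d : Fin 2 →₀ ℕ, d 0 < n → d 1 < n → MvPowerSeries.coeff d p = 0) :
    ∃ a b : PS K, p = MvPowerSeries.X 0 ^ n * a + MvPowerSeries.X 1 ^ n * b := by
  let q : PS K := fun d => if d 0 < n then 0 else MvPowerSeries.coeff d p
  have hq : ∀ d, MvPowerSeries.coeff d q = if d 0 < n then 0 else MvPowerSeries.coeff d p :=
    fun _ => rfl
  obtain ⟨a, ha⟩ : (MvPowerSeries.X 0 : PS K) ^ n ∣ q :=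
    MvPowerSeries.X_pow_dvd_iff.mpr fun d hd => by simp [hq, hd]
  obtain ⟨b, hb⟩ : (MvPowerSeries.X 1 : PS K) ^ n ∣ p - q :=
    MvPowerSeries.X_pow_dvd_iff.mpr fun d hd => by
      by_cases h0 : d 0 < n <;> simp [hq, h0, hp, hd]
  exact ⟨a, b, by rw [← ha, ← hb]; ring⟩

/-- Coprime power series in two variables have finite intersection multiplicity. -/
theorem finite_quotient_of_isRelPrime {g h : PS K} (hgh : IsRelPrime g h) :
    Module.Finite K (PS K ⧸ Ideal.span ({g, h} : Set (PS K))) := by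
  obtain ⟨n₀, h₀⟩ := X_mem_radical_of_isRelPrime hgh 0
  obtain ⟨n₁, h₁⟩ := X_mem_radical_of_isRelPrime hgh 1
  let n := n₀ + n₁
  refine finite_of_ker_le (Ideal.Quotient.mkₐ K (Ideal.span ({g, h} : Set (PS K)))).toLinearMap
    Ideal.Quotient.mk_surjective
    (LinearMap.pi fun ij : Fin n × Fin n => MvPowerSeries.coeff (R := K)
      (Finsupp.single (0 : Fin 2) (ij.1 : ℕ) + Finsupp.single 1 (ij.2 : ℕ))) fun p hp => ?_
  obtain ⟨a, b, rfl⟩ := mem_span_X_pow_of_coeff_eq_zero (n := n) (p := p) fun d hd₀ hd₁ => by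
    have := congrFun (LinearMap.mem_ker.mp hp) (⟨d 0, hd₀⟩, ⟨d 1, hd₁⟩)
    have hd : Finsupp.single (0 : Fin 2) (d 0) + Finsupp.single 1 (d 1) = d := by
      ext i; fin_cases i <;> simp
    simpa [hd] using this
  rw [LinearMap.mem_ker]
  refine Ideal.Quotient.eq_zero_iff_mem.mpr (Ideal.add_mem _ ?_ ?_)
  · exact Ideal.mul_mem_right _ _ (by rw [pow_add]; exact Ideal.mul_mem_right _ _ h₀)
  · exact Ideal.mul_mem_right _ _ (by rw [pow_add]; exact Ideal.mul_mem_left _ _ h₁)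

end PowerSeriesRing

section CompleteNakayama

open PowerSeries

variable {K}

/-- Nakayama's lemma over `K[[T]]` for separated modules: a finite family generating modulo `T`
generates. -/
theorem span_range_eq_top_of_separated {M ι : Type*} [AddCommGroup M] [Module K⟦X⟧ M] [Fintype ι]
    (hsep : ∀ m : M, (∀ n : ℕ, ∃ m', m = (X : K⟦X⟧) ^ n • m') → m = 0) (v : ι → M)
    (hv : ∀ m : M, ∃ (c : ι → K) (m' : M), m = ∑ i, C (c i) • v i + (X : K⟦X⟧) • m') :
    Submodule.span K⟦X⟧ (Set.range v) = ⊤ := by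
  choose c r hcr using hv
  refine eq_top_iff.mpr fun m _ => ?_
  let a : ι → K⟦X⟧ := fun i => PowerSeries.mk fun n => c (r^[n] m) i
  have key : ∀ n : ℕ, m = ∑ i, (trunc n (a i) : K⟦X⟧) • v i + (X : K⟦X⟧) ^ n • r^[n] m := by
    intro n
    induction n with
    | zero => simp
    | succ n ih =>
      have hstep : (X : K⟦X⟧) ^ n • r^[n] m =
          ∑ i, ((X : K⟦X⟧) ^ n * C (c (r^[n] m) i)) • v i + (X : K⟦X⟧) ^ (n + 1) • r^[n + 1] m := by
        conv_lhs => rw [hcr (r^[n] m)]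
        rw [smul_add, Finset.smul_sum, smul_smul, ← pow_succ, Function.iterate_succ_apply']
        simp only [smul_smul]
      conv_lhs => rw [ih, hstep]
      rw [← add_assoc, ← Finset.sum_add_distrib]
      congr 1
      refine Finset.sum_congr rfl fun i _ => ?_
      rw [← add_smul, trunc_succ, Polynomial.coe_add, Polynomial.coe_monomial,
        monomial_eq_C_mul_X_pow, mul_comm (X ^ n)]
      simp [a]
  have hm : m = ∑ i, a i • v i := by
    refine sub_eq_zero.mp (hsep _ fun n => ?_)
    choose b hb using fun i => (X_pow_dvd_iff (n := n) (φ := a i - (trunc n (a i) : K⟦X⟧))).mpr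
      fun j hj => by simp [coeff_trunc, hj]
    refine ⟨r^[n] m - ∑ i, b i • v i, ?_⟩
    have hs : ∑ i, a i • v i =
        ∑ i, (trunc n (a i) : K⟦X⟧) • v i + (X : K⟦X⟧) ^ n • ∑ i, b i • v i := by
      rw [Finset.smul_sum, ← Finset.sum_add_distrib]
      refine Finset.sum_congr rfl fun i _ => ?_
      rw [smul_smul, ← hb, ← add_smul, add_sub_cancel]
    conv_lhs => rw [key n, hs]
    rw [smul_sub]
    abel
  rw [hm]
  exact Submodule.sum_mem _ fun i _ =>
    Submodule.smul_mem _ _ (Submodule.subset_span (Set.mem_range_self i))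

/-- A `T`-adically separated `K[[T]]`-algebra, finite-dimensional modulo `T`, is a finite
module. -/
theorem finite_of_separated_of_finite_quotient {B : Type*} [CommRing B] [Algebra K B]
    [Algebra K⟦X⟧ B] [IsScalarTower K K⟦X⟧ B]
    (hsep : ∀ b : B, (∀ n : ℕ, algebraMap K⟦X⟧ B X ^ n ∣ b) → b = 0)
    [Module.Finite K (B ⧸ Ideal.span {algebraMap K⟦X⟧ B X})] : Module.Finite K⟦X⟧ B := by
  let I := Ideal.span {algebraMap K⟦X⟧ B X}
  let β := Module.finBasis K (B ⧸ I)
  choose v hv using fun i => Ideal.Quotient.mk_surjective (β i)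
  refine ⟨⟨Finset.univ.image v, ?_⟩⟩
  rw [Finset.coe_image, Finset.coe_univ, Set.image_univ]
  refine span_range_eq_top_of_separated (fun m hm => hsep m fun n => ?_) v fun m => ?_
  · obtain ⟨m', rfl⟩ := hm n
    exact ⟨m', by rw [Algebra.smul_def, map_pow]⟩
  · let c := β.repr (Ideal.Quotient.mk I m)
    have hmem : m - ∑ i, c i • v i ∈ I := by
      rw [← Ideal.Quotient.eq_zero_iff_mem, map_sub, map_sum, sub_eq_zero]
      conv_lhs => rw [← β.sum_repr (Ideal.Quotient.mk I m)]
      refine Finset.sum_congr rfl fun i _ => ?_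
      rw [← hv i]
      rfl
    obtain ⟨m', hm'⟩ := Ideal.mem_span_singleton.mp hmem
    refine ⟨c, m', ?_⟩
    rw [Algebra.smul_def X, ← hm']
    have : ∀ i, C (c i) • v i = c i • v i := fun i => by
      rw [← algebraMap_smul K⟦X⟧ (c i) (v i)]; rfl
    simp [this]

/-- Lifts of a `K`-basis modulo `T` are linearly independent over `K[[T]]`. -/
theorem linearIndependent_of_quotient {B ι : Type*} [CommRing B] [IsDomain B] [Algebra K B]
    [Algebra K⟦X⟧ B] [IsScalarTower K K⟦X⟧ B] (hX : algebraMap K⟦X⟧ B X ≠ 0) (v : ι → B)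
    (hv : LinearIndependent K fun i => Ideal.Quotient.mk (Ideal.span {algebraMap K⟦X⟧ B X}) (v i)) :
    LinearIndependent K⟦X⟧ v := by
  rw [linearIndependent_iff'] at hv ⊢
  intro s a ha
  have key : ∀ (n : ℕ) (a : ι → K⟦X⟧), ∑ i ∈ s, a i • v i = 0 → ∀ i ∈ s, X ^ n ∣ a i := by
    intro n
    induction n with
    | zero => simp
    | succ n ih =>
      intro a ha
      have h0 : ∀ i ∈ s, constantCoeff (a i) = 0 := by
        refine hv s (fun i => constantCoeff (a i)) ?_
        have hx : ∀ i, Ideal.Quotient.mk (Ideal.span {algebraMap K⟦X⟧ B X}) (a i • v i) =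
            constantCoeff (a i) • Ideal.Quotient.mk (Ideal.span {algebraMap K⟦X⟧ B X}) (v i) := by
          intro i
          have : constantCoeff (a i) • Ideal.Quotient.mk (Ideal.span {algebraMap K⟦X⟧ B X}) (v i) =
            Ideal.Quotient.mk (Ideal.span {algebraMap K⟦X⟧ B X})
              (C (constantCoeff (a i)) • v i) := by
            change Ideal.Quotient.mk _ (constantCoeff (a i) • v i) = _
            rw [← algebraMap_smul K⟦X⟧ (constantCoeff (a i)) (v i)]; rfl
          rw [this, Ideal.Quotient.eq, ← sub_smul, Ideal.mem_span_singleton]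
          obtain ⟨q, hq⟩ := X_dvd_iff.mpr
            (show constantCoeff (a i - C (constantCoeff (a i))) = 0 by simp)
          exact ⟨q • v i, by rw [hq, Algebra.smul_def, Algebra.smul_def, map_mul, mul_assoc]⟩
        have := congrArg (Ideal.Quotient.mk (Ideal.span {algebraMap K⟦X⟧ B X})) ha
        simpa only [map_sum, hx, map_zero] using this
      choose! a' ha' using fun i hi => X_dvd_iff.mpr (h0 i hi)
      have hsum : ∑ i ∈ s, a' i • v i = 0 := by
        refine (mul_eq_zero.mp ?_).resolve_left hX
        rw [← ha, Finset.mul_sum]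
        refine Finset.sum_congr rfl fun i hi => ?_
        rw [ha' i hi, Algebra.smul_def, Algebra.smul_def, map_mul, mul_assoc]
      intro i hi
      rw [ha' i hi, pow_succ']
      exact mul_dvd_mul_left _ (ih a' hsum i hi)
  intro i hi
  ext n
  exact X_pow_dvd_iff.mp (key (n + 1) a ha i hi) n n.lt_succ_self

/-- Every nonzero element of a domain integral over `K[[T]]` divides a power of `T`. -/
theorem exists_dvd_X_pow {B : Type*} [CommRing B] [IsDomain B] [Algebra K⟦X⟧ B]
    [Algebra.IsIntegral K⟦X⟧ B] {b : B} (hb : b ≠ 0) : ∃ k, b ∣ algebraMap K⟦X⟧ B X ^ k := by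
  have h := Ideal.comap_ne_bot_of_integral_mem (R := K⟦X⟧) hb (Ideal.mem_span_singleton_self b)
    (Algebra.IsIntegral.isIntegral b)
  obtain ⟨a, ha, ha0⟩ := Submodule.exists_mem_ne_zero_of_ne_bot h
  rw [Ideal.mem_comap, Ideal.mem_span_singleton] at ha
  obtain ⟨n, u, hu⟩ := IsDiscreteValuationRing.eq_unit_mul_pow_irreducible ha0
    (PowerSeries.X_irreducible (R := K))
  refine ⟨n, ?_⟩
  rw [hu, map_mul, map_pow] at ha
  exact ((u.isUnit.map _).dvd_mul_left).mp ha

theorem eq_zero_of_forall_X_pow_dvd {B : Type*} [CommRing B] [IsDomain B] [Algebra K⟦X⟧ B]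
    [Algebra.IsIntegral K⟦X⟧ B] (hinj : Function.Injective (algebraMap K⟦X⟧ B)) (b : B)
    (h : ∀ n : ℕ, algebraMap K⟦X⟧ B X ^ n ∣ b) : b = 0 := by
  by_contra hb
  obtain ⟨k, hk⟩ := exists_dvd_X_pow (K := K) hb
  have hX : algebraMap K⟦X⟧ B X ≠ 0 := by
    rw [← map_zero (algebraMap K⟦X⟧ B)]
    exact hinj.ne X_ne_zero
  obtain ⟨c, hc⟩ := (h (k + 1)).trans hk
  rw [pow_succ, mul_assoc] at hc
  have hunit : IsUnit (algebraMap K⟦X⟧ B X) :=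
    IsUnit.of_mul_eq_one c (mul_left_cancel₀ (pow_ne_zero k hX) (by rw [mul_one, ← hc]))
  have : FaithfulSMul K⟦X⟧ B := (faithfulSMul_iff_algebraMap_injective _ _).mpr hinj
  exact X_irreducible.not_isUnit (isUnit_of_map_unit (algebraMap K⟦X⟧ B) _ hunit)

/-- A domain integral over `K[[T]]` and birational to a finite `K[[T]]`-algebra is itself
finite. -/
theorem finite_of_isIntegral_of_birational {O B : Type*} [CommRing O] [CommRing B] [IsDomain B]
    [Algebra K B] [Algebra K⟦X⟧ B] [IsScalarTower K K⟦X⟧ B] [Algebra K⟦X⟧ O] [Algebra O B]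
    [IsScalarTower K⟦X⟧ O B] [Module.Finite K⟦X⟧ O] [Algebra.IsIntegral K⟦X⟧ B]
    (hinj : Function.Injective (algebraMap K⟦X⟧ B))
    (hfrac : ∀ b : B, ∃ c : O, algebraMap O B c ≠ 0 ∧ ∃ a, algebraMap O B c * b = algebraMap O B a) :
    Module.Finite K⟦X⟧ B := by
  have hX : algebraMap K⟦X⟧ B X ≠ 0 := by
    rw [← map_zero (algebraMap K⟦X⟧ B)]
    exact hinj.ne X_ne_zero
  have : Module.Finite K (B ⧸ Ideal.span {algebraMap K⟦X⟧ B X}) := by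
    let β := Module.Basis.ofVectorSpace K (B ⧸ Ideal.span {algebraMap K⟦X⟧ B X})
    choose v hv using fun i => Ideal.Quotient.mk_surjective (β i)
    have hlin : LinearIndependent K⟦X⟧ v :=
      linearIndependent_of_quotient hX v (by simpa only [hv] using β.linearIndependent)
    choose c hc a ha using hfrac
    have hfin : Finite (Module.Basis.ofVectorSpaceIndex K
        (B ⧸ Ideal.span {algebraMap K⟦X⟧ B X})) := by
      by_contra hinf
      rw [not_finite_iff_infinite] at hinf
      obtain ⟨n, s, hs⟩ := Submodule.fg_iff_exists_fin_generating_family.mp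
        (Module.Finite.fg_top (R := K⟦X⟧) (M := O))
      let emb := (Infinite.natEmbedding (Module.Basis.ofVectorSpaceIndex K
        (B ⧸ Ideal.span {algebraMap K⟦X⟧ B X})))
      let w : Fin (n + 1) → B := fun i => v (emb i)
      have hw : LinearIndependent K⟦X⟧ w :=
        hlin.comp (fun i : Fin (n + 1) => emb i) fun i j hij => Fin.ext (emb.injective hij)
      let d := ∏ i, c (w i)
      have hd : algebraMap O B d ≠ 0 := by
        rw [map_prod]
        exact Finset.prod_ne_zero_iff.mpr fun i _ => hc _
      have hdw : ∀ i, ∃ z : O, algebraMap O B z = algebraMap O B d * w i := fun i => by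
        obtain ⟨e, he⟩ : c (w i) ∣ d := Finset.dvd_prod_of_mem _ (Finset.mem_univ i)
        refine ⟨e * a (w i), ?_⟩
        rw [he, map_mul, map_mul, ← ha]
        ring
      choose z hz using hdw
      have hzlin : LinearIndependent K⟦X⟧ z := by
        refine LinearIndependent.of_comp (IsScalarTower.toAlgHom K⟦X⟧ O B).toLinearMap ?_
        have : (IsScalarTower.toAlgHom K⟦X⟧ O B).toLinearMap ∘ z =
            LinearMap.mulLeft K⟦X⟧ (algebraMap O B d) ∘ w := by
          ext i; simpa using hz i
        rw [this]
        exact hw.map' _ (LinearMap.ker_eq_bot.mpr (mul_right_injective₀ hd))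
      have hcard := linearIndependent_le_span_aux' z hzlin (Set.range s) (by rw [hs]; simp)
      have h2 := Fintype.card_range_le s
      simp at hcard h2
      omega
    exact Module.Finite.of_basis β
  exact finite_of_separated_of_finite_quotient (eq_zero_of_forall_X_pow_dvd hinj)

end CompleteNakayama

section DeltaModule

variable (O L : Type*) [CommRing O] [CommRing L] [Algebra K O] [Algebra K L] [Algebra O L]

/-- The `K`-span of the integral closure of `O` in `L`. -/
abbrev normalizationSubmodule : Submodule K L :=
  Submodule.span K (integralClosure O L : Set L)

/-- The `K`-span of the image of `O` in `L`. -/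
abbrev imageSubmodule : Submodule K L :=
  Submodule.span K (Set.range (algebraMap O L))

/-- The `K`-vector space `Ō/O`, with `Ō` the integral closure of `O` in `L`. -/
abbrev DeltaModule : Type _ :=
  ↥(normalizationSubmodule K O L) ⧸
    (imageSubmodule K O L).comap (normalizationSubmodule K O L).subtype

variable {K O L} [IsScalarTower K O L]

theorem mem_normalizationSubmodule {x : L} :
    x ∈ normalizationSubmodule K O L ↔ IsIntegral O x := by
  have : (integralClosure O L : Set L) =
      (Subalgebra.toSubmodule (integralClosure O L)).restrictScalars K := rfl
  rw [normalizationSubmodule, this, Submodule.span_eq]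
  rfl

theorem mem_imageSubmodule {x : L} :
    x ∈ imageSubmodule K O L ↔ ∃ a, algebraMap O L a = x := by
  have : Set.range (algebraMap O L) =
      (LinearMap.range (IsScalarTower.toAlgHom K O L).toLinearMap : Set L) := by
    ext; simp
  rw [imageSubmodule, this, Submodule.span_eq]
  simp

theorem deltaModule_mk_eq_zero {x : normalizationSubmodule K O L} :
    (Submodule.Quotient.mk x : DeltaModule K O L) = 0 ↔ ∃ a, algebraMap O L a = x := by
  rw [Submodule.Quotient.mk_eq_zero, Submodule.mem_comap, mem_imageSubmodule]
  rfl

/-- The space `Ō/O` does not depend on the model of the total ring of fractions. -/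
def deltaModuleEquiv {L' : Type*} [CommRing L'] [Algebra K L'] [Algebra O L']
    [IsScalarTower K O L'] (e : L ≃ₐ[O] L') : DeltaModule K O L ≃ₗ[K] DeltaModule K O L' :=
  Submodule.Quotient.equiv _ _
    ((e.restrictScalars K).toLinearEquiv.submoduleMap (normalizationSubmodule K O L) ≪≫ₗ
      LinearEquiv.ofEq _ (normalizationSubmodule K O L') (by
        ext y
        rw [mem_normalizationSubmodule, Submodule.mem_map]
        constructor
        · rintro ⟨x, hx, rfl⟩
          exact (mem_normalizationSubmodule.mp hx).map e
        · intro hy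
          exact ⟨e.symm y, mem_normalizationSubmodule.mpr (hy.map e.symm), by simp⟩)) (by
    ext y
    simp only [Submodule.mem_map, Submodule.mem_comap, mem_imageSubmodule]
    constructor
    · rintro ⟨x, ⟨a, ha⟩, rfl⟩
      exact ⟨a, (e.commutes a).symm.trans (congrArg e ha)⟩
    · rintro ⟨a, ha⟩
      have hmem : algebraMap O L a ∈ normalizationSubmodule K O L :=
        mem_normalizationSubmodule.mpr isIntegral_algebraMap
      exact ⟨⟨_, hmem⟩, ⟨a, rfl⟩, Subtype.ext ((e.commutes a).trans ha)⟩)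

open PowerSeries in
/-- The normalization of a domain which is finite over `K[[T]]` has finite colength. -/
theorem finite_deltaModule_of_isDomain {O L : Type*} [CommRing O] [IsDomain O] [Field L]
    [Algebra K O] [Algebra K L] [Algebra O L] [IsScalarTower K O L] [IsFractionRing O L]
    [Algebra K⟦X⟧ O] [IsScalarTower K K⟦X⟧ O] [Module.Finite K⟦X⟧ O]
    (hinj : Function.Injective (algebraMap K⟦X⟧ O)) :
    Module.Finite K (DeltaModule K O L) := by
  let _ : Algebra K⟦X⟧ L := ((algebraMap O L).comp (algebraMap K⟦X⟧ O)).toAlgebra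
  have : IsScalarTower K⟦X⟧ O L := .of_algebraMap_eq' rfl
  have : IsScalarTower K K⟦X⟧ L := .of_algebraMap_eq fun a => by
    rw [IsScalarTower.algebraMap_apply K O L, IsScalarTower.algebraMap_apply K K⟦X⟧ O,
      IsScalarTower.algebraMap_apply K⟦X⟧ O L]
  let B := integralClosure O L
  have hOL : Function.Injective (algebraMap O L) := IsFractionRing.injective O L
  have : Algebra.IsIntegral K⟦X⟧ B := Algebra.IsIntegral.trans O
  have hfrac : ∀ b : L, ∃ c : O, c ≠ 0 ∧ ∃ a, algebraMap O L c * b = algebraMap O L a := by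
    intro b
    obtain ⟨⟨a, c⟩, h⟩ := IsLocalization.surj (nonZeroDivisors O) b
    exact ⟨c, nonZeroDivisors.ne_zero c.2, a, by rw [mul_comm]; exact h⟩
  have hOB : Function.Injective (algebraMap O B) := fun a b hab => hOL (congrArg Subtype.val hab)
  have hfin : Module.Finite K⟦X⟧ B := by
    refine finite_of_isIntegral_of_birational (O := O) ?_ fun b => ?_
    · rw [IsScalarTower.algebraMap_eq K⟦X⟧ O B]
      exact hOB.comp hinj
    · obtain ⟨c, hc, a, ha⟩ := hfrac b
      exact ⟨c, fun h => hc (hOB (h.trans (map_zero _).symm)), a, Subtype.ext ha⟩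
  obtain ⟨n, v, hv⟩ := Submodule.fg_iff_exists_fin_generating_family.mp hfin.fg_top
  choose c hc a ha using hfrac
  obtain ⟨k, hk⟩ := exists_dvd_X_pow (K := K)
    (Finset.prod_ne_zero_iff.mpr fun (i : Fin n) _ => hc (v i))
  have hXv : ∀ i, ∃ z : O, algebraMap O L z = ((X : K⟦X⟧) ^ k • v i : B) := fun i => by
    obtain ⟨e, he⟩ := (Finset.dvd_prod_of_mem (fun i => c (v i)) (Finset.mem_univ i)).trans hk
    refine ⟨e * a (v i), ?_⟩
    rw [map_mul, ← ha, Algebra.smul_def]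
    change _ = algebraMap K⟦X⟧ L (X ^ k) * (v i : L)
    rw [IsScalarTower.algebraMap_apply K⟦X⟧ O L, map_pow, he, map_mul]
    ring
  choose z hz using hXv
  let π : (Fin n → K⟦X⟧) →ₗ[K] DeltaModule K O L :=
    (Submodule.mkQ _) ∘ₗ
      LinearMap.codRestrict (normalizationSubmodule K O L)
        ((IsScalarTower.toAlgHom K B L).toLinearMap ∘ₗ
          (Fintype.linearCombination K⟦X⟧ v).restrictScalars K)
        fun x => mem_normalizationSubmodule.mpr (Subtype.prop (Fintype.linearCombination K⟦X⟧ v x))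
  refine finite_of_ker_le π (fun y => ?_)
    (LinearMap.pi fun ij : Fin n × Fin k =>
      (PowerSeries.coeff (R := K) (ij.2 : ℕ)) ∘ₗ LinearMap.proj ij.1) fun x hx => ?_
  · obtain ⟨⟨y, hy⟩, rfl⟩ := Submodule.Quotient.mk_surjective _ y
    have : (⟨y, mem_normalizationSubmodule.mp hy⟩ : B) ∈ Submodule.span K⟦X⟧ (Set.range v) :=
      hv ▸ Submodule.mem_top
    rw [← Fintype.range_linearCombination] at this
    obtain ⟨x, hx⟩ := this
    have hxy : ((Fintype.linearCombination K⟦X⟧ v x : B) : L) = y := congrArg Subtype.val hx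
    exact ⟨x, congrArg Submodule.Quotient.mk (Subtype.ext hxy)⟩
  · have hdvd : ∀ i, (X : K⟦X⟧) ^ k ∣ x i := fun i => X_pow_dvd_iff.mpr fun j hj =>
      congrFun (LinearMap.mem_ker.mp hx) (i, ⟨j, hj⟩)
    choose x' hx' using hdvd
    rw [LinearMap.mem_ker]
    refine deltaModule_mk_eq_zero.mpr ⟨∑ i, algebraMap K⟦X⟧ O (x' i) * z i, ?_⟩
    change _ = ((Fintype.linearCombination K⟦X⟧ v x : B) : L)
    rw [Fintype.linearCombination_apply, map_sum, AddSubmonoidClass.coe_finsetSum]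
    refine Finset.sum_congr rfl fun i _ => ?_
    rw [map_mul, hz, hx' i, mul_comm (X ^ k), mul_smul, Algebra.smul_def (x' i)]
    rfl

end DeltaModule

section CurveRing

variable {K}

theorem delta_eq_finrank (f : PS K) (L : Type u) [CommRing L] [Algebra K L]
    [Algebra (CurveRing K f) L] [IsScalarTower K (CurveRing K f) L]
    [IsFractionRing (CurveRing K f) L] :
    delta K f = Module.finrank K (DeltaModule K (CurveRing K f) L) := by
  have hspec : {d | deltaSpec K f d} =
      {Module.finrank K (DeltaModule K (CurveRing K f) L)} := by
    ext d
    constructor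
    · intro hd
      exact hd L
    · rintro rfl L' _ _ _ _ _
      exact (deltaModuleEquiv (IsLocalization.algEquiv
        (nonZeroDivisors (CurveRing K f)) L L')).finrank_eq
  rw [delta, hspec, csInf_singleton]

theorem delta_of_isUnit {f : PS K} (hf : IsUnit f) : delta K f = 0 := by
  have : Subsingleton (CurveRing K f) :=
    Ideal.Quotient.subsingleton_iff.mpr (Ideal.span_singleton_eq_top.mpr hf)
  have : Subsingleton (FractionRing (CurveRing K f)) := Algebra.subsingleton (CurveRing K f) _
  rw [delta_eq_finrank f (FractionRing (CurveRing K f))]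
  exact Module.finrank_zero_of_subsingleton

theorem prime_X_zero : Prime (MvPowerSeries.X 0 : PS K) := by
  have : IsDomain (MvPowerSeries (Fin 1) K) := NoZeroDivisors.to_isDomain _
  rw [← MulEquiv.prime_iff (MvPowerSeries.finSuccEquiv K 1)]
  rw [MvPowerSeries.finSuccEquiv_X_zero]
  exact PowerSeries.X_prime

/-- An irreducible power series is coprime to one of the variables. -/
theorem exists_isRelPrime_X {p : PS K} (hp : Irreducible p) :
    ∃ i, IsRelPrime p (MvPowerSeries.X i) := by
  by_contra! h
  have hdvd : ∀ i, p ∣ MvPowerSeries.X i := fun i =>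
    not_not.mp fun hi => h i (hp.isRelPrime_iff_not_dvd.mpr hi)
  have h01 : (MvPowerSeries.X 0 : PS K) ∣ MvPowerSeries.X 1 :=
    ((hp.dvd_irreducible_iff_associated prime_X_zero.irreducible).mp (hdvd 0)).symm.dvd.trans
      (hdvd 1)
  have := MvPowerSeries.X_dvd_iff.mp h01 (Finsupp.single 1 1) (by simp)
  simp at this

open PowerSeries in
theorem finite_deltaModule_of_irreducible {p : PS K} (hp : Irreducible p) :
    Module.Finite K (DeltaModule K (CurveRing K p) (FractionRing (CurveRing K p))) := by
  obtain ⟨i, hi⟩ := exists_isRelPrime_X hp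
  have hprime : (Ideal.span {p}).IsPrime :=
    (Ideal.span_singleton_prime hp.ne_zero).mpr hp.prime
  have : IsDomain (CurveRing K p) := Ideal.Quotient.isDomain _
  let φ : K⟦X⟧ →ₐ[K] CurveRing K p :=
    (Ideal.Quotient.mkₐ K (Ideal.span {p})).comp (MvPowerSeries.rename fun _ : Unit => i)
  let _ : Algebra K⟦X⟧ (CurveRing K p) := φ.toRingHom.toAlgebra
  have : IsScalarTower K K⟦X⟧ (CurveRing K p) := .of_algebraMap_eq fun a => (φ.commutes a).symm
  have hX : algebraMap K⟦X⟧ (CurveRing K p) X = Ideal.Quotient.mk _ (MvPowerSeries.X i) :=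
    congrArg (Ideal.Quotient.mk _) (MvPowerSeries.rename_X _ _)
  have hX0 : algebraMap K⟦X⟧ (CurveRing K p) X ≠ 0 := by
    rw [hX, Ne, Ideal.Quotient.eq_zero_iff_mem, Ideal.mem_span_singleton]
    exact hp.isRelPrime_iff_not_dvd.mp hi
  have hXunit : ¬ IsUnit (algebraMap K⟦X⟧ (CurveRing K p) X) := by
    rw [hX]
    intro h
    obtain ⟨b, hb⟩ := h.exists_right_inv
    obtain ⟨b, rfl⟩ := Ideal.Quotient.mk_surjective b
    rw [← map_mul, ← map_one (Ideal.Quotient.mk _), Ideal.Quotient.eq,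
      Ideal.mem_span_singleton] at hb
    obtain ⟨c, hc⟩ := hb
    have hp0 : MvPowerSeries.constantCoeff p = 0 := by
      by_contra h0
      exact hp.not_isUnit (MvPowerSeries.isUnit_iff_constantCoeff.mpr (isUnit_iff_ne_zero.mpr h0))
    have := congrArg MvPowerSeries.constantCoeff hc
    simp [hp0] at this
  have hinj : Function.Injective (algebraMap K⟦X⟧ (CurveRing K p)) := by
    rw [injective_iff_map_eq_zero]
    intro a ha
    by_contra ha0
    obtain ⟨n, u, rfl⟩ := IsDiscreteValuationRing.eq_unit_mul_pow_irreducible ha0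
      (PowerSeries.X_irreducible (R := K))
    rw [map_mul, map_pow, mul_eq_zero] at ha
    exact ha.elim (u.isUnit.map _).ne_zero (pow_ne_zero n hX0)
  have : Module.Finite K
      (CurveRing K p ⧸ Ideal.span {algebraMap K⟦X⟧ (CurveRing K p) X}) := by
    have := finite_quotient_of_isRelPrime hi
    let ψ : (PS K ⧸ Ideal.span {p, MvPowerSeries.X i}) →ₐ[K]
        (CurveRing K p ⧸ Ideal.span {algebraMap K⟦X⟧ (CurveRing K p) X}) :=
      Ideal.Quotient.liftₐ _ ((Ideal.Quotient.mkₐ K _).comp (Ideal.Quotient.mkₐ K _)) (by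
        have : Ideal.span {p, MvPowerSeries.X i} ≤ RingHom.ker
            ((Ideal.Quotient.mk (Ideal.span {algebraMap K⟦X⟧ (CurveRing K p) X})).comp
              (Ideal.Quotient.mk (Ideal.span {p}))) := by
          rw [Ideal.span_le, Set.insert_subset_iff, Set.singleton_subset_iff]
          constructor
          · simp [RingHom.mem_ker, Ideal.Quotient.eq_zero_iff_mem.mpr
              (Ideal.mem_span_singleton_self p)]
          · rw [SetLike.mem_coe, RingHom.mem_ker, RingHom.comp_apply, ← hX]
            exact Ideal.Quotient.eq_zero_iff_mem.mpr (Ideal.mem_span_singleton_self _)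
        exact fun a ha => this ha)
    refine Module.Finite.of_surjective ψ.toLinearMap fun y => ?_
    obtain ⟨y, rfl⟩ := Ideal.Quotient.mk_surjective y
    obtain ⟨y, rfl⟩ := Ideal.Quotient.mk_surjective y
    exact ⟨Ideal.Quotient.mk _ y, rfl⟩
  have : Module.Finite K⟦X⟧ (CurveRing K p) := by
    refine finite_of_separated_of_finite_quotient (K := K) fun b hb => ?_
    have hbot := Ideal.iInf_pow_eq_bot_of_isDomain
      (Ideal.span {algebraMap K⟦X⟧ (CurveRing K p) X})
      (fun h => hXunit (Ideal.span_singleton_eq_top.mp h))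
    rw [← Ideal.mem_bot, ← hbot, Ideal.mem_iInf]
    intro n
    rw [Ideal.span_singleton_pow, Ideal.mem_span_singleton]
    exact hb n
  exact finite_deltaModule_of_isDomain hinj

end CurveRing

section Product

variable {K}

/-- Dimension count for a short exact sequence `0 → S/I → V → W → 0`. -/
theorem finite_and_finrank_of_exact {S V W : Type*} [CommRing S] [Algebra K S] [AddCommGroup V]
    [Module K V] [AddCommGroup W] [Module K W] (I : Ideal S) [Module.Finite K (S ⧸ I)]
    [Module.Finite K W] (α : S →ₗ[K] V) (hα : ∀ x, α x = 0 ↔ x ∈ I) (β : V →ₗ[K] W)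
    (hβ : Function.Surjective β) (hexact : ∀ v, β v = 0 ↔ ∃ x, α x = v) :
    Module.Finite K V ∧ Module.finrank K V = Module.finrank K (S ⧸ I) + Module.finrank K W := by
  have hker : LinearMap.ker α = I.restrictScalars K := by
    ext x; simpa using hα x
  have hrange : LinearMap.ker β = LinearMap.range α := by
    ext v; simpa using hexact v
  let e : (S ⧸ I) ≃ₗ[K] LinearMap.ker β :=
    (Submodule.Quotient.restrictScalarsEquiv K I).symm ≪≫ₗ Submodule.quotEquivOfEq _ _ hker.symm ≪≫ₗ
      α.quotKerEquivRange ≪≫ₗ LinearEquiv.ofEq _ _ hrange.symm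
  have : Module.Finite K (LinearMap.ker β) := Module.Finite.equiv e
  have : Module.Finite K (V ⧸ LinearMap.ker β) :=
    Module.Finite.equiv (β.quotKerEquivOfSurjective hβ).symm
  refine ⟨Module.Finite.of_submodule_quotient (LinearMap.ker β), ?_⟩
  have := Module.Finite.of_submodule_quotient (LinearMap.ker β)
  rw [← (LinearMap.ker β).finrank_quotient_add_finrank, e.finrank_eq,
    (β.quotKerEquivOfSurjective hβ).finrank_eq, add_comm]

theorem iMult_mul_left {g h k : PS K} (hgk : IsRelPrime g k) (hhk : IsRelPrime h k) (hg : g ≠ 0) :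
    iMult K (g * h) k = iMult K g k + iMult K h k := by
  have := finite_quotient_of_isRelPrime hgk
  have := finite_quotient_of_isRelPrime hhk
  have hle : Ideal.span {g * h, k} ≤ Ideal.span {g, k} := by
    rw [Ideal.span_le, Set.insert_subset_iff, Set.singleton_subset_iff]
    exact ⟨Ideal.mul_mem_right _ _ (Ideal.subset_span (by simp)), Ideal.subset_span (by simp)⟩
  rw [iMult, (finite_and_finrank_of_exact (Ideal.span {h, k})
    ((Ideal.Quotient.mkₐ K (Ideal.span {g * h, k})).toLinearMap ∘ₗ LinearMap.mulLeft K g) ?_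
    (Ideal.Quotient.factorₐ K hle).toLinearMap (Ideal.Quotient.factor_surjective hle) ?_).2,
    add_comm]
  · rfl
  · intro x
    change Ideal.Quotient.mk _ (g * x) = 0 ↔ _
    rw [Ideal.Quotient.eq_zero_iff_mem, Ideal.mem_span_pair, Ideal.mem_span_pair]
    constructor
    · rintro ⟨a, b, hab⟩
      obtain ⟨c, rfl⟩ : g ∣ b := hgk.dvd_of_dvd_mul_right ⟨x - a * h, by linear_combination hab⟩
      exact ⟨a, c, mul_left_cancel₀ hg (by linear_combination hab)⟩
    · rintro ⟨a, b, rfl⟩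
      exact ⟨a, g * b, by ring⟩
  · intro v
    obtain ⟨v, rfl⟩ := Ideal.Quotient.mk_surjective v
    change Ideal.Quotient.mk _ v = 0 ↔ ∃ x, Ideal.Quotient.mk _ (g * x) = Ideal.Quotient.mk _ v
    simp only [Ideal.Quotient.eq_zero_iff_mem, Ideal.Quotient.eq, Ideal.mem_span_pair]
    constructor
    · rintro ⟨a, b, rfl⟩
      exact ⟨a, 0, -b, by ring⟩
    · rintro ⟨x, a, b, hab⟩
      exact ⟨x - a * h, -b, by linear_combination -hab⟩

section FractionRing

variable {g h : PS K} (L₁ L₂ : Type u) [CommRing L₁] [CommRing L₂] [Algebra (CurveRing K g) L₁]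
  [Algebra (CurveRing K h) L₂]

/-- The canonical map from `K[[x,y]]/(gh)` to the product of extensions of `K[[x,y]]/(g)` and
`K[[x,y]]/(h)`. -/
def curveRingMulHom (g h : PS K) (L₁ L₂ : Type u) [CommRing L₁] [CommRing L₂]
    [Algebra (CurveRing K g) L₁] [Algebra (CurveRing K h) L₂] :
    CurveRing K (g * h) →+* L₁ × L₂ :=
  ((algebraMap (CurveRing K g) L₁).comp (Ideal.Quotient.factor
    (Ideal.span_singleton_le_span_singleton.mpr (Dvd.intro h rfl)))).prod
  ((algebraMap (CurveRing K h) L₂).comp (Ideal.Quotient.factor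
    (Ideal.span_singleton_le_span_singleton.mpr (Dvd.intro_left g rfl))))

theorem curveRingMulHom_mk (a : PS K) :
    curveRingMulHom g h L₁ L₂ (Ideal.Quotient.mk _ a) =
      (algebraMap (CurveRing K g) L₁ (Ideal.Quotient.mk _ a),
        algebraMap (CurveRing K h) L₂ (Ideal.Quotient.mk _ a)) := rfl

theorem mk_mem_nonZeroDivisors_iff {g a : PS K} :
    Ideal.Quotient.mk (Ideal.span {g}) a ∈ nonZeroDivisors (CurveRing K g) ↔
      ∀ b, g ∣ b * a → g ∣ b := by
  rw [mem_nonZeroDivisors_iff_right]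
  constructor
  · intro H b hb
    rw [← Ideal.mem_span_singleton, ← Ideal.Quotient.eq_zero_iff_mem] at hb ⊢
    exact H _ (by rw [← hb, map_mul])
  · intro H b hb
    obtain ⟨b, rfl⟩ := Ideal.Quotient.mk_surjective b
    rw [← map_mul] at hb
    rw [Ideal.Quotient.eq_zero_iff_mem, Ideal.mem_span_singleton] at hb ⊢
    exact H b hb

variable [IsFractionRing (CurveRing K g) L₁] [IsFractionRing (CurveRing K h) L₂]

theorem algebraMap_mk_eq_zero_iff {a : PS K} :
    algebraMap (CurveRing K g) L₁ (Ideal.Quotient.mk _ a) = 0 ↔ g ∣ a := by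
  rw [map_eq_zero_iff _ (IsFractionRing.injective (CurveRing K g) L₁),
    Ideal.Quotient.eq_zero_iff_mem, Ideal.mem_span_singleton]

theorem curveRingMulHom_injective (hgh : IsRelPrime g h) :
    Function.Injective (curveRingMulHom g h L₁ L₂) := by
  rw [injective_iff_map_eq_zero]
  intro a ha
  obtain ⟨a, rfl⟩ := Ideal.Quotient.mk_surjective a
  rw [curveRingMulHom_mk, Prod.mk_eq_zero, algebraMap_mk_eq_zero_iff,
    algebraMap_mk_eq_zero_iff] at ha
  rw [Ideal.Quotient.eq_zero_iff_mem, Ideal.mem_span_singleton]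
  exact hgh.mul_dvd ha.1 ha.2

/-- For coprime `g` and `h`, the total ring of fractions of `K[[x,y]]/(gh)` is the product of those
of `K[[x,y]]/(g)` and `K[[x,y]]/(h)`. -/
theorem isFractionRing_prod (hgh : IsRelPrime g h) (hg : g ≠ 0) (hh : h ≠ 0) :
    letI := (curveRingMulHom g h L₁ L₂).toAlgebra
    IsFractionRing (CurveRing K (g * h)) (L₁ × L₂) := by
  let _ := (curveRingMulHom g h L₁ L₂).toAlgebra
  have hinj := curveRingMulHom_injective L₁ L₂ hgh
  refine ⟨fun s => ?_, fun z => ?_, fun {x y} hxy => ⟨1, by rw [hinj hxy]⟩⟩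
  · obtain ⟨s, hs⟩ := s
    obtain ⟨s, rfl⟩ := Ideal.Quotient.mk_surjective s
    rw [mk_mem_nonZeroDivisors_iff] at hs
    refine Prod.isUnit_iff.mpr ⟨?_, ?_⟩
    · refine IsLocalization.map_units L₁ (⟨Ideal.Quotient.mk _ s, mk_mem_nonZeroDivisors_iff.mpr
        fun b hb => ?_⟩ : nonZeroDivisors (CurveRing K g))
      refine (mul_dvd_mul_iff_right hh).mp (hs _ ?_)
      rw [mul_right_comm]
      exact mul_dvd_mul_right hb h
    · refine IsLocalization.map_units L₂ (⟨Ideal.Quotient.mk _ s, mk_mem_nonZeroDivisors_iff.mpr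
        fun b hb => ?_⟩ : nonZeroDivisors (CurveRing K h))
      refine (mul_dvd_mul_iff_left hg).mp (hs _ ?_)
      rw [mul_assoc]
      exact mul_dvd_mul_left g hb
  · obtain ⟨z₁, z₂⟩ := z
    obtain ⟨⟨a, s, hs⟩, h₁⟩ := IsLocalization.surj (nonZeroDivisors (CurveRing K g)) z₁
    obtain ⟨⟨b, t, ht⟩, h₂⟩ := IsLocalization.surj (nonZeroDivisors (CurveRing K h)) z₂
    obtain ⟨a, rfl⟩ := Ideal.Quotient.mk_surjective a
    obtain ⟨b, rfl⟩ := Ideal.Quotient.mk_surjective b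
    obtain ⟨s, rfl⟩ := Ideal.Quotient.mk_surjective s
    obtain ⟨t, rfl⟩ := Ideal.Quotient.mk_surjective t
    rw [mk_mem_nonZeroDivisors_iff] at hs ht
    have hgmem : Ideal.Quotient.mk (Ideal.span {g}) g = 0 :=
      Ideal.Quotient.eq_zero_iff_mem.mpr (Ideal.mem_span_singleton_self g)
    have hhmem : Ideal.Quotient.mk (Ideal.span {h}) h = 0 :=
      Ideal.Quotient.eq_zero_iff_mem.mpr (Ideal.mem_span_singleton_self h)
    refine ⟨(Ideal.Quotient.mk _ (a * h + b * g), ⟨Ideal.Quotient.mk _ (s * h + t * g),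
      mk_mem_nonZeroDivisors_iff.mpr fun c hc => hgh.mul_dvd ?_ ?_⟩), ?_⟩
    · refine hs c (hgh.dvd_of_dvd_mul_right ?_)
      have := (Dvd.intro h rfl : g ∣ g * h).trans hc
      rw [mul_add] at this
      rw [mul_assoc]
      exact (dvd_add_left ⟨c * t, by ring⟩).mp this
    · refine ht c (hgh.symm.dvd_of_dvd_mul_right ?_)
      have := (Dvd.intro_left g rfl : h ∣ g * h).trans hc
      rw [mul_add] at this
      rw [mul_assoc]
      exact (dvd_add_right ⟨c * s, by ring⟩).mp this
    · change (z₁, z₂) * curveRingMulHom g h L₁ L₂ _ = curveRingMulHom g h L₁ L₂ _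
      rw [curveRingMulHom_mk, curveRingMulHom_mk, Prod.mk_mul_mk]
      simp only [map_add, map_mul, hgmem, hhmem, mul_zero, add_zero, zero_add, ← mul_assoc]
      dsimp only at h₁ h₂
      rw [h₁, h₂]

end FractionRing

end Product

section Delta

variable {K} {g h : PS K}

section

variable (L₁ L₂ : Type u) [CommRing L₁] [CommRing L₂] [Algebra (CurveRing K g) L₁]
  [Algebra (CurveRing K h) L₂]

theorem isIntegral_prod_iff {z₁ : L₁} {z₂ : L₂} :
    (curveRingMulHom g h L₁ L₂).IsIntegralElem (z₁, z₂) ↔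
      IsIntegral (CurveRing K g) z₁ ∧ IsIntegral (CurveRing K h) z₂ := by
  constructor
  · rintro ⟨p, hp, hpz⟩
    have h₁ := congrArg (RingHom.fst L₁ L₂) hpz
    have h₂ := congrArg (RingHom.snd L₁ L₂) hpz
    rw [Polynomial.hom_eval₂, map_zero] at h₁ h₂
    refine ⟨⟨p.map (Ideal.Quotient.factor
      (Ideal.span_singleton_le_span_singleton.mpr (Dvd.intro h rfl))), hp.map _, ?_⟩,
      ⟨p.map (Ideal.Quotient.factor
      (Ideal.span_singleton_le_span_singleton.mpr (Dvd.intro_left g rfl))), hp.map _, ?_⟩⟩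
    · rw [Polynomial.eval₂_map]
      exact h₁
    · rw [Polynomial.eval₂_map]
      exact h₂
  · rintro ⟨⟨p, hp, hpz⟩, ⟨q, hq, hqz⟩⟩
    obtain ⟨P, rfl, -, hP⟩ := Polynomial.lifts_and_natDegree_eq_and_monic
      ((Polynomial.mem_lifts p).mpr (Polynomial.map_surjective _ (Ideal.Quotient.factor_surjective
        (Ideal.span_singleton_le_span_singleton.mpr (Dvd.intro h rfl : g ∣ g * h))) p)) hp
    obtain ⟨Q, rfl, -, hQ⟩ := Polynomial.lifts_and_natDegree_eq_and_monic
      ((Polynomial.mem_lifts q).mpr (Polynomial.map_surjective _ (Ideal.Quotient.factor_surjective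
        (Ideal.span_singleton_le_span_singleton.mpr (Dvd.intro_left g rfl : h ∣ g * h))) q)) hq
    rw [Polynomial.eval₂_map] at hpz hqz
    refine ⟨P * Q, hP.mul hQ, Prod.ext ?_ ?_⟩
    · change RingHom.fst L₁ L₂ _ = 0
      rw [Polynomial.hom_eval₂, Polynomial.eval₂_mul]
      exact (congrArg (· * _) hpz).trans (zero_mul _)
    · change RingHom.snd L₁ L₂ _ = 0
      rw [Polynomial.hom_eval₂, Polynomial.eval₂_mul]
      exact (congrArg (_ * ·) hqz).trans (mul_zero _)

variable [Algebra K L₁] [Algebra K L₂] [IsScalarTower K (CurveRing K g) L₁]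
  [IsScalarTower K (CurveRing K h) L₂]

theorem isScalarTower_prod :
    letI := (curveRingMulHom g h L₁ L₂).toAlgebra
    IsScalarTower K (CurveRing K (g * h)) (L₁ × L₂) := by
  let _ := (curveRingMulHom g h L₁ L₂).toAlgebra
  exact IsScalarTower.of_algebraMap_eq (R := K) (S := CurveRing K (g * h)) (A := L₁ × L₂) fun a =>
    Prod.ext (IsScalarTower.algebraMap_apply K (CurveRing K g) L₁ a)
      (IsScalarTower.algebraMap_apply K (CurveRing K h) L₂ a)

variable [IsFractionRing (CurveRing K g) L₁] [IsFractionRing (CurveRing K h) L₂]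

/-- The short exact sequence `0 → K[[x,y]]/(g,h) → Ō/O → Ō₁/O₁ × Ō₂/O₂ → 0`, where `O`, `O₁`, `O₂`
are the local rings of `gh`, `g` and `h`. -/
theorem finite_and_finrank_deltaModule_prod (hgh : IsRelPrime g h)
    [Module.Finite K (DeltaModule K (CurveRing K g) L₁)]
    [Module.Finite K (DeltaModule K (CurveRing K h) L₂)] :
    letI := (curveRingMulHom g h L₁ L₂).toAlgebra
    Module.Finite K (DeltaModule K (CurveRing K (g * h)) (L₁ × L₂)) ∧
      Module.finrank K (DeltaModule K (CurveRing K (g * h)) (L₁ × L₂)) =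
        Module.finrank K (DeltaModule K (CurveRing K g) L₁) +
          Module.finrank K (DeltaModule K (CurveRing K h) L₂) + iMult K g h := by
  let _ := (curveRingMulHom g h L₁ L₂).toAlgebra
  have := isScalarTower_prod (g := g) (h := h) L₁ L₂
  have := finite_quotient_of_isRelPrime hgh
  have hmem (z : L₁ × L₂) : z ∈ normalizationSubmodule K (CurveRing K (g * h)) (L₁ × L₂) ↔
      z.1 ∈ normalizationSubmodule K (CurveRing K g) L₁ ∧
        z.2 ∈ normalizationSubmodule K (CurveRing K h) L₂ := by
    rw [mem_normalizationSubmodule, mem_normalizationSubmodule, mem_normalizationSubmodule]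
    exact isIntegral_prod_iff L₁ L₂
  have himage (z : L₁ × L₂) : (∃ a, algebraMap (CurveRing K (g * h)) (L₁ × L₂) a = z) ↔
      ∃ a : PS K, algebraMap (CurveRing K g) L₁ (Ideal.Quotient.mk _ a) = z.1 ∧
        algebraMap (CurveRing K h) L₂ (Ideal.Quotient.mk _ a) = z.2 := by
    rw [Ideal.Quotient.mk_surjective.exists]
    exact exists_congr fun a => Prod.ext_iff
  let α : PS K →ₗ[K] DeltaModule K (CurveRing K (g * h)) (L₁ × L₂) :=
    Submodule.mkQ _ ∘ₗ LinearMap.codRestrict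
      (normalizationSubmodule K (CurveRing K (g * h)) (L₁ × L₂))
      (LinearMap.inl K L₁ L₂ ∘ₗ (IsScalarTower.toAlgHom K (CurveRing K g) L₁).toLinearMap ∘ₗ
        (Ideal.Quotient.mkₐ K (Ideal.span {g})).toLinearMap) fun w => (hmem _).mpr
          ⟨mem_normalizationSubmodule.mpr isIntegral_algebraMap, Submodule.zero_mem _⟩
  let β : DeltaModule K (CurveRing K (g * h)) (L₁ × L₂) →ₗ[K]
      DeltaModule K (CurveRing K g) L₁ × DeltaModule K (CurveRing K h) L₂ :=
    Submodule.liftQ _ (LinearMap.prod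
      (Submodule.mkQ _ ∘ₗ ((LinearMap.fst K L₁ L₂).restrict fun z hz => ((hmem z).mp hz).1))
      (Submodule.mkQ _ ∘ₗ ((LinearMap.snd K L₁ L₂).restrict fun z hz => ((hmem z).mp hz).2)))
      fun z hz => by
        obtain ⟨a, h₁, h₂⟩ := (himage _).mp (mem_imageSubmodule.mp (Submodule.mem_comap.mp hz))
        exact Prod.ext (deltaModule_mk_eq_zero.mpr ⟨_, h₁⟩) (deltaModule_mk_eq_zero.mpr ⟨_, h₂⟩)
  have hα_eq_mk (z : L₁ × L₂) (hz) (w : PS K) :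
      α w = Submodule.Quotient.mk ⟨z, hz⟩ ↔
        ∃ a : PS K, algebraMap (CurveRing K g) L₁ (Ideal.Quotient.mk _ a) =
          algebraMap (CurveRing K g) L₁ (Ideal.Quotient.mk _ w) - z.1 ∧
        algebraMap (CurveRing K h) L₂ (Ideal.Quotient.mk _ a) = 0 - z.2 := by
    rw [← sub_eq_zero]
    exact deltaModule_mk_eq_zero.trans (himage _)
  rw [iMult, add_comm, ← Module.finrank_prod]
  refine finite_and_finrank_of_exact (Ideal.span {g, h}) α (fun w => ?_) β ?_ ?_
  · refine (hα_eq_mk 0 (Submodule.zero_mem _) w).trans ?_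
    simp only [Prod.fst_zero, Prod.snd_zero, sub_zero, ← sub_eq_zero (b := algebraMap _ L₁ _),
      ← map_sub, algebraMap_mk_eq_zero_iff, Ideal.mem_span_pair]
    constructor
    · rintro ⟨a, ⟨b, hb⟩, c, rfl⟩
      exact ⟨-b, c, by linear_combination hb⟩
    · rintro ⟨a, b, rfl⟩
      exact ⟨b * h, ⟨-a, by ring⟩, ⟨b, by ring⟩⟩
  · rintro ⟨z₁, z₂⟩
    obtain ⟨⟨z₁, h₁⟩, rfl⟩ := Submodule.Quotient.mk_surjective _ z₁
    obtain ⟨⟨z₂, h₂⟩, rfl⟩ := Submodule.Quotient.mk_surjective _ z₂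
    exact ⟨Submodule.Quotient.mk ⟨(z₁, z₂), (hmem _).mpr ⟨h₁, h₂⟩⟩, rfl⟩
  · intro v
    obtain ⟨⟨z, hz⟩, rfl⟩ := Submodule.Quotient.mk_surjective _ v
    simp only [hα_eq_mk]
    refine Prod.ext_iff.trans ((and_congr deltaModule_mk_eq_zero deltaModule_mk_eq_zero).trans ?_)
    change (∃ a, algebraMap (CurveRing K g) L₁ a = z.1) ∧
      (∃ b, algebraMap (CurveRing K h) L₂ b = z.2) ↔ _
    rw [Ideal.Quotient.mk_surjective.exists, Ideal.Quotient.mk_surjective.exists]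
    constructor
    · rintro ⟨⟨a, ha⟩, b, hb⟩
      exact ⟨a - b, -b, by rw [← ha]; simp, by rw [← hb]; simp⟩
    · rintro ⟨w, a, ha, hb⟩
      exact ⟨⟨w - a, by rw [map_sub, map_sub, ha]; ring⟩, -a, by rw [map_neg, map_neg, hb]; ring⟩

end

theorem finite_deltaModule_mul_and_delta_mul (hgh : IsRelPrime g h) (hg : g ≠ 0) (hh : h ≠ 0)
    [Module.Finite K (DeltaModule K (CurveRing K g) (FractionRing (CurveRing K g)))]
    [Module.Finite K (DeltaModule K (CurveRing K h) (FractionRing (CurveRing K h)))] :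
    Module.Finite K (DeltaModule K (CurveRing K (g * h)) (FractionRing (CurveRing K (g * h)))) ∧
      delta K (g * h) = delta K g + delta K h + iMult K g h := by
  obtain ⟨hfin, hrank⟩ := finite_and_finrank_deltaModule_prod (FractionRing (CurveRing K g))
    (FractionRing (CurveRing K h)) hgh
  let L := FractionRing (CurveRing K g) × FractionRing (CurveRing K h)
  let _ : Algebra (CurveRing K (g * h)) L := (curveRingMulHom g h _ _).toAlgebra
  have : IsFractionRing (CurveRing K (g * h)) L := isFractionRing_prod _ _ hgh hg hh
  have : IsScalarTower K (CurveRing K (g * h)) L := isScalarTower_prod _ _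
  let e := deltaModuleEquiv (K := K) (IsLocalization.algEquiv
    (nonZeroDivisors (CurveRing K (g * h))) L (FractionRing (CurveRing K (g * h))))
  refine ⟨Module.Finite.equiv e, ?_⟩
  rw [delta_eq_finrank (g * h) L, delta_eq_finrank g (FractionRing (CurveRing K g)),
    delta_eq_finrank h (FractionRing (CurveRing K h))]
  exact hrank

/-- The `δ`-invariant of a reduced power series is finite. -/
theorem finite_deltaModule_of_squarefree {f : PS K} (hf : Squarefree f) :
    Module.Finite K (DeltaModule K (CurveRing K f) (FractionRing (CurveRing K f))) := by
  induction f using UniqueFactorizationMonoid.induction_on_prime with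
  | h₁ => exact absurd hf not_squarefree_zero
  | h₂ u hu =>
    have : Subsingleton (CurveRing K u) :=
      Ideal.Quotient.subsingleton_iff.mpr (Ideal.span_singleton_eq_top.mpr hu)
    have : Subsingleton (FractionRing (CurveRing K u)) :=
      (algebraMap (CurveRing K u) (FractionRing (CurveRing K u))).codomain_trivial
    infer_instance
  | h₃ a p ha hp ih =>
    have := finite_deltaModule_of_irreducible hp.irreducible
    have := ih (hf.squarefree_of_dvd (Dvd.intro_left p rfl))
    exact (finite_deltaModule_mul_and_delta_mul (IsRelPrime.of_squarefree_mul hf) hp.ne_zero ha).1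

theorem delta_mul (hsq : Squarefree (g * h)) (hgh : IsRelPrime g h) :
    delta K (g * h) = delta K g + delta K h + iMult K g h :=
  have := finite_deltaModule_of_squarefree (hsq.squarefree_of_dvd (Dvd.intro h rfl))
  have := finite_deltaModule_of_squarefree (hsq.squarefree_of_dvd (Dvd.intro_left g rfl))
  (finite_deltaModule_mul_and_delta_mul hgh (left_ne_zero_of_mul hsq.ne_zero)
    (right_ne_zero_of_mul hsq.ne_zero)).2

end Delta

section MuBar

variable {K} {g h : PS K}

theorem numFactors_of_isUnit (hg : IsUnit g) : numFactors K g = 0 := by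
  have : {P : Associates (PS K) | Irreducible P ∧ P ∣ Associates.mk g} = ∅ :=
    Set.eq_empty_of_forall_notMem fun P hP =>
      hP.1.not_isUnit (isUnit_of_dvd_unit hP.2 (Associates.isUnit_mk.mpr hg))
  rw [numFactors, this, Set.ncard_empty]

theorem numFactors_mul (hgh : IsRelPrime g h) (hg : g ≠ 0) (hh : h ≠ 0) :
    numFactors K (g * h) = numFactors K g + numFactors K h := by
  have hfin (f : PS K) (hf : f ≠ 0) :
      {P : Associates (PS K) | Irreducible P ∧ P ∣ Associates.mk f}.Finite := by
    have := UniqueFactorizationMonoid.fintypeSubtypeDvd (Associates.mk f)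
      (Associates.mk_ne_zero.mpr hf)
    exact (Set.toFinite (Set.range (Subtype.val : {P // P ∣ Associates.mk f} → _))).subset
      fun P hP => ⟨⟨P, hP.2⟩, rfl⟩
  rw [numFactors, numFactors, numFactors, ← Set.ncard_union_eq ?_ (hfin g hg) (hfin h hh)]
  · congr 1
    ext P
    rw [Set.mem_union, Set.mem_ofPred_eq, Set.mem_ofPred_eq, Set.mem_ofPred_eq, ← and_or_left,
      ← Associates.mk_mul_mk]
    exact and_congr_right fun hP => hP.prime.dvd_mul
  · rw [Set.disjoint_left]
    rintro P ⟨hP, hPg⟩ ⟨-, hPh⟩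
    obtain ⟨p, rfl⟩ := Associates.mk_surjective P
    rw [Associates.mk_dvd_mk] at hPg hPh
    exact hP.not_isUnit (Associates.isUnit_mk.mpr (hgh hPg hPh))

theorem muBar_mul (hsq : Squarefree (g * h)) (hgh : IsRelPrime g h) :
    muBar K (g * h) = muBar K g + muBar K h - 1 + 2 * iMult K g h := by
  rw [muBar, muBar, muBar, delta_mul hsq hgh, numFactors_mul hgh (left_ne_zero_of_mul hsq.ne_zero)
    (right_ne_zero_of_mul hsq.ne_zero)]
  push_cast
  ring

theorem muBar_of_isUnit (hg : IsUnit g) : muBar K g = 1 := by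
  simp [muBar, delta_of_isUnit hg, numFactors_of_isUnit hg]

theorem iMult_one_left : iMult K 1 h = 0 := by
  have : Subsingleton (PS K ⧸ Ideal.span {1, h}) := Ideal.Quotient.subsingleton_iff.mpr
    (Ideal.eq_top_of_isUnit_mem _ (Ideal.subset_span (by simp)) isUnit_one)
  exact Module.finrank_zero_of_subsingleton

theorem iMult_comm : iMult K g h = iMult K h g := by
  rw [iMult, iMult, Set.pair_comm]

theorem iMult_prod_right {ι : Type*} (s : Finset ι) (φ : ι → PS K)
    (hφ : ∀ i ∈ s, IsRelPrime h (φ i)) (hne : ∀ i ∈ s, φ i ≠ 0) :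
    iMult K h (∏ i ∈ s, φ i) = ∑ i ∈ s, iMult K h (φ i) := by
  induction s using Finset.cons_induction with
  | empty => rw [Finset.prod_empty, Finset.sum_empty, iMult_comm, iMult_one_left]
  | cons a s ha ih =>
    rw [Finset.forall_mem_cons] at hφ hne
    rw [Finset.prod_cons, Finset.sum_cons, iMult_comm, iMult_mul_left hφ.1.symm
      (IsRelPrime.prod_left fun i hi => (hφ.2 i hi).symm) hne.1, iMult_comm,
      iMult_comm (h := h), ih hφ.2 hne.2]

theorem muBar_prod_of_squarefree (s : ℕ) (φ : Fin s → PS K) (hsq : Squarefree (∏ i, φ i))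
    (hφ : ∀ i j, i ≠ j → IsRelPrime (φ i) (φ j)) :
    muBar K (∏ i, φ i) + s - 1 = (∑ i, muBar K (φ i)) +
      2 * ∑ i, ∑ j, (if i < j then (iMult K (φ i) (φ j) : ℤ) else 0) := by
  induction s with
  | zero => simp [muBar_of_isUnit]
  | succ s ih =>
    rw [Fin.prod_univ_succ] at hsq
    have hrel : ∀ j : Fin s, IsRelPrime (φ 0) (φ j.succ) := fun j => hφ _ _ (Fin.succ_ne_zero j).symm
    have hne : ∀ j : Fin s, φ j.succ ≠ 0 := fun j =>
      Finset.prod_ne_zero_iff.mp (right_ne_zero_of_mul hsq.ne_zero) j (Finset.mem_univ j)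
    have := ih (fun j => φ j.succ) (hsq.squarefree_of_dvd (Dvd.intro_left _ rfl))
      fun i j hij => hφ _ _ (Fin.succ_injective s |>.ne hij)
    rw [Fin.prod_univ_succ, muBar_mul hsq (IsRelPrime.prod_right fun j _ => hrel j),
      iMult_prod_right _ _ (fun j _ => hrel j) fun j _ => hne j]
    simp only [Fin.sum_univ_succ, if_false, Fin.succ_pos, if_true,
      Fin.not_lt_zero, Fin.succ_lt_succ_iff, zero_add]
    push_cast
    linear_combination this

end MuBar

theorem muBar_prod (K : Type u) [Field K] [IsAlgClosed K]
    (s : ℕ) (g : Fin s → PS K) (f : PS K) (hfg : f = ∏ i, g i)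
    (hred : IsReducedSeries K f)
    (hcop : ∀ i j, i ≠ j → ∀ p : PS K, p ∣ g i → p ∣ g j → IsUnit p) :
    muBar K f + s - 1 =
      (∑ i, muBar K (g i)) +
        2 * ∑ i, ∑ j, (if i < j then (iMult K (g i) (g j) : ℤ) else 0) := by
  subst hfg
  exact muBar_prod_of_squarefree s g hred.2.2 fun i j hij p => hcop i j hij p

end PlaneCurveNote
end
end
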